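/- For every r > 0, the Lebesgue measure of the set of positions of a moving ball of radius r hitting the oloid, λ{ x ∈ ℝ³ : Ω_r ∩ B̄(x,r) ≠ ∅ }, equals (r³/6)·[ 9π² + 32π + 8E(√3/2) + 22K(√3/2) − 24I ]. -/

import Mathlib

open MeasureTheory Real Pointwise

noncomputable section

/-- The circle `k_A = {(x,y,z) : x² + (y+1/2)² = 1 ∧ z = 0}`. -/
def kA : Set (EuclideanSpace ℝ (Fin 3)) :=
  {p | p 0 ^ 2 + (p 1 + 1/2) ^ 2 = 1 ∧ p 2 = 0}

/-- The circle `k_B = {(x,y,z) : (y−1/2)² + z² = 1 ∧ x = 0}`. -/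
def kB : Set (EuclideanSpace ℝ (Fin 3)) :=
  {p | (p 1 - 1/2) ^ 2 + p 2 ^ 2 = 1 ∧ p 0 = 0}

/-- The oloid `Ω₁`: the convex hull of `k_A ∪ k_B`. -/
def oloid : Set (EuclideanSpace ℝ (Fin 3)) := convexHull ℝ (kA ∪ kB)

/-- The scaled oloid `Ω_r = r • Ω₁`. -/
def oloidR (r : ℝ) : Set (EuclideanSpace ℝ (Fin 3)) := r • oloid

/-- Complete elliptic integral of the first kind `K(k)`. -/
def ellipticK (k : ℝ) : ℝ := ∫ x in (0:ℝ)..(π/2), 1 / Real.sqrt (1 - k^2 * Real.sin x ^ 2)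

/-- Complete elliptic integral of the second kind `E(k)`. -/
def ellipticE (k : ℝ) : ℝ := ∫ x in (0:ℝ)..(π/2), Real.sqrt (1 - k^2 * Real.sin x ^ 2)

/-- The constant `I = ∫₀^{π/2} arccos(cos x/(1+cos x)) dx`. -/
def constI : ℝ := ∫ x in (0:ℝ)..(π/2), Real.arccos (Real.cos x / (1 + Real.cos x))

/-- Support function `h_C(u) = sup {⟨x,u⟩ : x ∈ C}` of a set `C ⊆ ℝ³`. -/
def suppFn (C : Set (EuclideanSpace ℝ (Fin 3))) (u : EuclideanSpace ℝ (Fin 3)) : ℝ :=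
  sSup ((fun x => (inner ℝ x u : ℝ)) '' C)

/-- Mean width of `C`: `(1/(4π)) ∫_{S²} (h_C(u) + h_C(−u)) dσ(u)`, where `σ` is the
2-dimensional Hausdorff measure on the unit sphere. (For `C = ∅` this gives `0`.) -/
def meanWidth (C : Set (EuclideanSpace ℝ (Fin 3))) : ℝ :=
  (1 / (4 * π)) *
    ∫ u in Metric.sphere (0 : EuclideanSpace ℝ (Fin 3)) 1, (suppFn C u + suppFn C (-u)) ∂μH[2]

/-- The rotation group `SO(3)` as 3×3 real orthogonal matrices of determinant 1. -/
abbrev SO3 := Matrix.specialOrthogonalGroup (Fin 3) ℝ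

instance : MeasurableSpace SO3 := borel SO3

instance : BorelSpace SO3 := ⟨rfl⟩

/-- The action of a rotation `θ ∈ SO(3)` on a point of `ℝ³`. -/
def rotate (θ : SO3) (p : EuclideanSpace ℝ (Fin 3)) : EuclideanSpace ℝ (Fin 3) :=
  (EuclideanSpace.equiv (Fin 3) ℝ).symm (Matrix.mulVec θ.1 (EuclideanSpace.equiv (Fin 3) ℝ p))

/-- `θ·S + x`: the image of `S` under the rotation `θ` followed by translation by `x`. -/
def moveSet (θ : SO3) (x : EuclideanSpace ℝ (Fin 3)) (S : Set (EuclideanSpace ℝ (Fin 3))) :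
    Set (EuclideanSpace ℝ (Fin 3)) :=
  (fun p => rotate θ p + x) '' S

/-- Euclidean three-space. -/
abbrev E3 := EuclideanSpace ℝ (Fin 3)

/-- The coordinates of a point of `E3` as an iterated pair. -/
def coords : E3 ≃L[ℝ] ℝ × ℝ × ℝ :=
  LinearEquiv.toContinuousLinearEquiv
    { toFun := fun x => (x 0, x 1, x 2)
      invFun := fun y => !₂[y.1, y.2.1, y.2.2]
      map_add' := fun _ _ => rfl
      map_smul' := fun _ _ => rfl
      left_inv := fun x => by ext i; fin_cases i <;> rfl
      right_inv := fun _ => rfl }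

lemma coords_apply (x : E3) : coords x = (x 0, x 1, x 2) := rfl

lemma measurePreserving_coords : MeasurePreserving coords volume volume :=
  (((MeasurePreserving.id (volume : Measure ℝ)).prod (volume_preserving_finTwoArrow ℝ)).comp
    (volume_preserving_piFinSuccAbove (fun _ : Fin 3 => ℝ) 0)).comp
      (PiLp.volume_preserving_ofLp (Fin 3))

/-- The determinant of the matrix with columns `u`, `v`, `w`. -/
def tripleDet (u v w : E3) : ℝ :=
  u 0 * (v 1 * w 2 - v 2 * w 1) - v 0 * (u 1 * w 2 - u 2 * w 1) + w 0 * (u 1 * v 2 - u 2 * v 1)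

lemma det_comp_coords (L : ℝ × ℝ × ℝ →L[ℝ] E3) :
    (L.comp (coords : E3 →L[ℝ] ℝ × ℝ × ℝ)).det
      = tripleDet (L (1, 0, 0)) (L (0, 1, 0)) (L (0, 0, 1)) := by
  have h0 : coords (EuclideanSpace.single 0 1) = (1, 0, 0) := by simp [coords_apply]
  have h1 : coords (EuclideanSpace.single 1 1) = (0, 1, 0) := by simp [coords_apply]
  have h2 : coords (EuclideanSpace.single 2 1) = (0, 0, 1) := by simp [coords_apply]
  rw [ContinuousLinearMap.det,
    ← LinearMap.det_toMatrix (EuclideanSpace.basisFun (Fin 3) ℝ).toBasis, Matrix.det_fin_three]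
  simp [LinearMap.toMatrix_apply, h0, h1, h2, tripleDet]
  ring

/-- The volume of the injective image of a set under a map with prescribed partial derivatives. -/
lemma volume_image_eq_lintegral {D : Set (ℝ × ℝ × ℝ)} (hD : MeasurableSet D)
    {F : ℝ → ℝ → ℝ → E3} (hF : Differentiable ℝ fun x : ℝ × ℝ × ℝ => F x.1 x.2.1 x.2.2)
    (hinj : Set.InjOn (fun x : ℝ × ℝ × ℝ => F x.1 x.2.1 x.2.2) D)
    {u v w : ℝ → ℝ → ℝ → E3}
    (hu : ∀ a b c, HasDerivAt (fun s => F s b c) (u a b c) a)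
    (hv : ∀ a b c, HasDerivAt (fun s => F a s c) (v a b c) b)
    (hw : ∀ a b c, HasDerivAt (fun s => F a b s) (w a b c) c) :
    volume ((fun x : ℝ × ℝ × ℝ => F x.1 x.2.1 x.2.2) '' D) =
      ∫⁻ x in D, ENNReal.ofReal |tripleDet (u x.1 x.2.1 x.2.2) (v x.1 x.2.1 x.2.2)
        (w x.1 x.2.1 x.2.2)| := by
  set G : ℝ × ℝ × ℝ → E3 := fun x => F x.1 x.2.1 x.2.2 with hG
  have h1 : ∀ x, fderiv ℝ G x (1, 0, 0) = u x.1 x.2.1 x.2.2 := fun x => by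
    have hc : HasDerivAt (fun s : ℝ => (s, x.2.1, x.2.2)) ((1 : ℝ), (0 : ℝ), (0 : ℝ)) x.1 :=
      (hasDerivAt_id x.1).prodMk (hasDerivAt_const _ _)
    exact (HasFDerivAt.comp_hasDerivAt (f := fun s : ℝ => (s, x.2.1, x.2.2)) x.1
      (hF x).hasFDerivAt hc).unique
      (hu x.1 x.2.1 x.2.2)
  have h2 : ∀ x, fderiv ℝ G x (0, 1, 0) = v x.1 x.2.1 x.2.2 := fun x => by
    have hc : HasDerivAt (fun s : ℝ => (x.1, s, x.2.2)) ((0 : ℝ), (1 : ℝ), (0 : ℝ)) x.2.1 :=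
      (hasDerivAt_const _ _).prodMk ((hasDerivAt_id x.2.1).prodMk (hasDerivAt_const _ _))
    exact (HasFDerivAt.comp_hasDerivAt (f := fun s : ℝ => (x.1, s, x.2.2)) x.2.1
      (hF x).hasFDerivAt hc).unique
      (hv x.1 x.2.1 x.2.2)
  have h3 : ∀ x, fderiv ℝ G x (0, 0, 1) = w x.1 x.2.1 x.2.2 := fun x => by
    have hc : HasDerivAt (fun s : ℝ => (x.1, x.2.1, s)) ((0 : ℝ), (0 : ℝ), (1 : ℝ)) x.2.2 :=
      (hasDerivAt_const _ _).prodMk ((hasDerivAt_const _ _).prodMk (hasDerivAt_id x.2.2))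
    exact (HasFDerivAt.comp_hasDerivAt (f := fun s : ℝ => (x.1, x.2.1, s)) x.2.2
      (hF x).hasFDerivAt hc).unique
      (hw x.1 x.2.1 x.2.2)
  have hcomp : ∀ x ∈ coords ⁻¹' D, HasFDerivWithinAt (G ∘ coords)
      ((fderiv ℝ G (coords x)).comp (coords : E3 →L[ℝ] ℝ × ℝ × ℝ)) (coords ⁻¹' D) x := fun x _ =>
    ((hF _).hasFDerivAt.comp x coords.hasFDerivAt).hasFDerivWithinAt
  have hinj' : Set.InjOn (G ∘ coords) (coords ⁻¹' D) :=
    hinj.comp coords.injective.injOn fun _ hx => hx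
  have key := lintegral_abs_det_fderiv_eq_addHaar_image volume
    (measurePreserving_coords.measurable hD) hcomp hinj'
  rw [Set.image_comp, Set.image_preimage_eq _ coords.surjective] at key
  rw [← key]
  simp only [det_comp_coords, h1, h2, h3]
  exact measurePreserving_coords.setLIntegral_comp_preimage_emb
    coords.toHomeomorph.measurableEmbedding (fun x => ENNReal.ofReal
      |tripleDet (u x.1 x.2.1 x.2.2) (v x.1 x.2.1 x.2.2) (w x.1 x.2.1 x.2.2)|) D

/-- Fubini's theorem for a continuous function on the region between two graphs. -/
lemma lintegral_eq_iterated {J : ℝ → ℝ → ℝ → ℝ}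
    (hJ : Continuous fun x : ℝ × ℝ × ℝ => J x.1 x.2.1 x.2.2)
    {α : ℝ} (hα : 0 ≤ α) {g : ℝ → ℝ} (hg : Continuous g) (hg0 : ∀ a ∈ Set.Ioo 0 α, 0 ≤ g a)
    {D : Set (ℝ × ℝ × ℝ)} (hD : MeasurableSet D) {S : ℝ → Set ℝ}
    (hS : ∀ a, S a =ᵐ[volume] Set.Ioc 0 (g a))
    (hDS : ∀ a b c, (a, b, c) ∈ D ↔ a ∈ Set.Ioo 0 α ∧ b ∈ S a ∧ c ∈ Set.Ioc (0 : ℝ) 1)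
    (hpos : ∀ a ∈ Set.Ioo 0 α, ∀ b ∈ Set.Ioc 0 (g a), ∀ c ∈ Set.Ioc (0 : ℝ) 1, 0 ≤ J a b c) :
    ∫⁻ x in D, ENNReal.ofReal (J x.1 x.2.1 x.2.2) =
      ENNReal.ofReal (∫ a in (0 : ℝ)..α, ∫ b in (0 : ℝ)..g a, ∫ c in (0 : ℝ)..1, J a b c) := by
  have h1 : Continuous fun x : ℝ × ℝ => ∫ c in (0 : ℝ)..1, J x.1 x.2 c :=
    intervalIntegral.continuous_parametric_intervalIntegral_of_continuous'
      (f := fun (x : ℝ × ℝ) c => J x.1 x.2 c)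
      (hJ.comp (by fun_prop : Continuous fun y : (ℝ × ℝ) × ℝ => (y.1.1, y.1.2, y.2))) 0 1
  have h2 : Continuous fun a : ℝ => ∫ b in (0 : ℝ)..g a, ∫ c in (0 : ℝ)..1, J a b c :=
    intervalIntegral.continuous_parametric_intervalIntegral_of_continuous
      (f := fun a b => ∫ c in (0 : ℝ)..1, J a b c) h1 hg
  have conv : ∀ {f : ℝ → ℝ} {β : ℝ}, Continuous f → 0 ≤ β → (∀ x ∈ Set.Ioo 0 β, 0 ≤ f x) →
      ∫⁻ x in Set.Ioc 0 β, ENNReal.ofReal (f x) = ENNReal.ofReal (∫ x in (0 : ℝ)..β, f x) := by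
    intro f β hf hβ h0
    rw [intervalIntegral.integral_of_le hβ, ofReal_integral_eq_lintegral_ofReal
      (hf.integrableOn_Ioc)]
    rw [← restrict_Ioo_eq_restrict_Ioc]
    exact (ae_restrict_iff' measurableSet_Ioo).2 (.of_forall h0)
  have pos1 : ∀ a ∈ Set.Ioo 0 α, ∀ b ∈ Set.Ioc 0 (g a), 0 ≤ ∫ c in (0 : ℝ)..1, J a b c := by
    intro a ha b hb
    rw [intervalIntegral.integral_of_le zero_le_one]
    exact setIntegral_nonneg measurableSet_Ioc fun c hc => hpos a ha b hb c hc
  have pos2 : ∀ a ∈ Set.Ioo 0 α, 0 ≤ ∫ b in (0 : ℝ)..g a, ∫ c in (0 : ℝ)..1, J a b c := by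
    intro a ha
    rw [intervalIntegral.integral_of_le (hg0 a ha)]
    exact setIntegral_nonneg measurableSet_Ioc fun b hb => pos1 a ha b hb
  have hmeas : Measurable fun x : ℝ × ℝ × ℝ => ENNReal.ofReal (J x.1 x.2.1 x.2.2) :=
    hJ.measurable.ennreal_ofReal
  rw [← conv h2 hα pos2, ← lintegral_indicator hD, Measure.volume_eq_prod,
    lintegral_prod _ (hmeas.indicator hD).aemeasurable, ← restrict_Ioo_eq_restrict_Ioc,
    ← lintegral_indicator measurableSet_Ioo]
  refine lintegral_congr fun a => ?_
  by_cases ha : a ∈ Set.Ioo 0 α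
  swap
  · rw [Set.indicator_of_notMem ha]
    refine (lintegral_congr fun y => ?_).trans lintegral_zero
    exact Set.indicator_of_notMem (fun h => ha ((hDS a y.1 y.2).1 h).1) _
  have hma : Measurable fun y : ℝ × ℝ =>
      D.indicator (fun x => ENNReal.ofReal (J x.1 x.2.1 x.2.2)) (a, y) :=
    (hmeas.indicator hD).comp measurable_prodMk_left
  rw [Set.indicator_of_mem ha, Measure.volume_eq_prod, lintegral_prod _ hma.aemeasurable]
  have hb : ∀ b, ∫⁻ c, D.indicator (fun x => ENNReal.ofReal (J x.1 x.2.1 x.2.2)) (a, b, c)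
      = (S a).indicator (fun b => ∫⁻ c in Set.Ioc 0 1, ENNReal.ofReal (J a b c)) b := by
    intro b
    by_cases hbS : b ∈ S a
    · rw [Set.indicator_of_mem hbS, ← lintegral_indicator measurableSet_Ioc]
      refine lintegral_congr fun c => ?_
      by_cases hc : c ∈ Set.Ioc (0 : ℝ) 1
      · rw [Set.indicator_of_mem hc, Set.indicator_of_mem ((hDS a b c).2 ⟨ha, hbS, hc⟩)]
      · rw [Set.indicator_of_notMem hc,
          Set.indicator_of_notMem fun h => hc ((hDS a b c).1 h).2.2]
    · rw [Set.indicator_of_notMem hbS]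
      refine (lintegral_congr fun c => ?_).trans lintegral_zero
      exact Set.indicator_of_notMem (fun h => hbS ((hDS a b c).1 h).2.1) _
  simp only [hb]
  rw [lintegral_congr_ae (indicator_ae_eq_of_ae_eq_set (hS a)),
    lintegral_indicator measurableSet_Ioc,
    ← conv (f := fun b => ∫ c in (0 : ℝ)..1, J a b c)
      (h1.comp (by fun_prop : Continuous fun b : ℝ => (a, b))) (hg0 a ha)
      fun b hb => pos1 a ha b ⟨hb.1, hb.2.le⟩]
  refine setLIntegral_congr_fun measurableSet_Ioc fun b hb' => ?_
  exact conv (hJ.comp (by fun_prop : Continuous fun c : ℝ => (a, b, c))) zero_le_one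
    fun c hc => hpos a ha b hb' c ⟨hc.1, hc.2.le⟩

/-- The elliptic delta amplitude `√(1 - k² sin² ψ)` at the modulus `k = √3 / 2`. -/
def ellDelta (ψ : ℝ) : ℝ := √(1 - 3 / 4 * sin ψ ^ 2)

lemma ellDelta_arg_pos (ψ : ℝ) : 0 < 1 - 3 / 4 * sin ψ ^ 2 := by
  nlinarith [sin_sq_le_one ψ]

lemma ellDelta_sq (ψ : ℝ) : ellDelta ψ ^ 2 = 1 - 3 / 4 * sin ψ ^ 2 :=
  sq_sqrt (ellDelta_arg_pos ψ).le

lemma ellDelta_pos (ψ : ℝ) : 0 < ellDelta ψ := sqrt_pos.2 (ellDelta_arg_pos ψ)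

lemma ellDelta_ne_zero (ψ : ℝ) : ellDelta ψ ≠ 0 := (ellDelta_pos ψ).ne'

lemma continuous_ellDelta : Continuous ellDelta := by
  unfold ellDelta
  fun_prop

lemma hasDerivAt_ellDelta (ψ : ℝ) :
    HasDerivAt ellDelta (-(3 / 4 * sin ψ * cos ψ / ellDelta ψ)) ψ := by
  have h := ((((hasDerivAt_sin ψ).pow 2).const_mul (3 / 4 : ℝ)).const_sub 1).sqrt
    (ellDelta_arg_pos ψ).ne'
  refine h.congr_deriv ?_
  change _ / (2 * ellDelta ψ) = _
  have := ellDelta_ne_zero ψ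
  field_simp
  ring

lemma sqrt_three_div_two_sq : (√3 / 2 : ℝ) ^ 2 = 3 / 4 := by
  rw [div_pow, sq_sqrt (by norm_num)]; norm_num

lemma ellipticK_eq : ellipticK (√3 / 2) = ∫ ψ in (0 : ℝ)..(π / 2), 1 / ellDelta ψ := by
  simp only [ellipticK, sqrt_three_div_two_sq, ellDelta]

lemma ellipticE_eq : ellipticE (√3 / 2) = ∫ ψ in (0 : ℝ)..(π / 2), ellDelta ψ := by
  simp only [ellipticE, sqrt_three_div_two_sq, ellDelta]

lemma intervalIntegrable_inv_ellDelta_pow (n : ℕ) (a b : ℝ) :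
    IntervalIntegrable (fun ψ => 1 / ellDelta ψ ^ n) volume a b :=
  (continuous_const.div (continuous_ellDelta.pow n)
    fun ψ => pow_ne_zero n (ellDelta_ne_zero ψ)).intervalIntegrable a b

lemma integral_inv_ellDelta_sq : ∫ ψ in (0 : ℝ)..(π / 2), 1 / ellDelta ψ ^ 2 = π := by
  have hd : ∀ ψ : ℝ, HasDerivAt
      (fun ψ => 2 * ψ - 2 * arctan (sin ψ * cos ψ / (1 + cos ψ ^ 2)))
      (1 / ellDelta ψ ^ 2) ψ := by
    intro ψ
    have h0 : (1 + cos ψ ^ 2) ≠ 0 := by positivity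
    have h := ((hasDerivAt_id ψ).const_mul 2).sub ((((hasDerivAt_sin ψ).mul
      (hasDerivAt_cos ψ)).div (((hasDerivAt_cos ψ).pow 2).const_add 1) h0).arctan.const_mul 2)
    refine h.congr_deriv ?_
    have hs : sin ψ ^ 2 = 1 - cos ψ ^ 2 := sin_sq ψ
    have hX : 1 + (sin ψ * cos ψ / (1 + cos ψ ^ 2)) ^ 2
        = (1 + 3 * cos ψ ^ 2) / (1 + cos ψ ^ 2) ^ 2 := by
      rw [div_pow, mul_pow, hs]
      field_simp
      ring
    have hY : (cos ψ * cos ψ + sin ψ * -sin ψ) * (1 + cos ψ ^ 2)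
        - sin ψ * cos ψ * (2 * cos ψ ^ (2 - 1) * -sin ψ) = 3 * cos ψ ^ 2 - 1 := by
      ring_nf
      rw [hs]
      ring
    have hZ : (1 - 3 / 4 * (1 - cos ψ ^ 2)) = (1 + 3 * cos ψ ^ 2) / 4 := by ring
    have h3 : 1 + 3 * cos ψ ^ 2 ≠ 0 := by positivity
    rw [ellDelta_sq, hs, hZ]
    change 2 * 1 - 2 * (1 / (1 + (sin ψ * cos ψ / (1 + cos ψ ^ 2)) ^ 2) *
      (((cos ψ * cos ψ + sin ψ * -sin ψ) * (1 + cos ψ ^ 2)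
        - sin ψ * cos ψ * (2 * cos ψ ^ (2 - 1) * -sin ψ)) / (1 + cos ψ ^ 2) ^ 2)) = _
    rw [hX, hY]
    field_simp
    ring
  rw [intervalIntegral.integral_eq_sub_of_hasDerivAt (fun x _ => hd x)
    (intervalIntegrable_inv_ellDelta_pow 2 _ _)]
  simp
  ring

lemma integral_inv_ellDelta_cube :
    ∫ ψ in (0 : ℝ)..(π / 2), 1 / ellDelta ψ ^ 3 = 4 * ellipticE (√3 / 2) := by
  have hd : ∀ ψ : ℝ, HasDerivAt (fun ψ => 3 * (sin ψ * cos ψ) / ellDelta ψ)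
      (4 * ellDelta ψ - 1 / ellDelta ψ ^ 3) ψ := by
    intro ψ
    refine ((((hasDerivAt_sin ψ).mul (hasDerivAt_cos ψ)).const_mul 3).div
      (hasDerivAt_ellDelta ψ) (ellDelta_ne_zero ψ)).congr_deriv ?_
    have h0 := ellDelta_ne_zero ψ
    have h1 := ellDelta_sq ψ
    have hs := sin_sq_add_cos_sq ψ
    have e1 : cos ψ ^ 2 = (4 * ellDelta ψ ^ 2 - 1) / 3 := by linarith
    have e2 : sin ψ ^ 2 = 4 * (1 - ellDelta ψ ^ 2) / 3 := by linarith
    simp only [Pi.mul_apply]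
    field_simp
    ring_nf
    simp only [e1, e2]
    ring
  have hint : IntervalIntegrable (fun ψ => 4 * ellDelta ψ) volume 0 (π / 2) :=
    (continuous_const.mul continuous_ellDelta).intervalIntegrable _ _
  have h := intervalIntegral.integral_eq_sub_of_hasDerivAt (fun x _ => hd x)
    (hint.sub (intervalIntegrable_inv_ellDelta_pow 3 0 (π / 2)))
  rw [intervalIntegral.integral_sub hint (intervalIntegrable_inv_ellDelta_pow 3 _ _),
    intervalIntegral.integral_const_mul, ← ellipticE_eq] at h
  simp at h
  simp only [one_div]
  linarith

lemma integral_one_sub : ∫ m in (0 : ℝ)..1, (1 - m) = 1 / 2 := by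
  rw [intervalIntegral.integral_sub (by simp) (by simp)]
  norm_num [integral_id]

/-- The volume of the part of the oloid in one quadrant, as an iterated integral. -/
lemma integral_cone : ∫ ψ in (0 : ℝ)..(π / 2), ∫ m in (0 : ℝ)..1, ∫ s in (0 : ℝ)..1,
      s ^ 2 * ((1 - m) * (3 * cos ψ ^ 2 * (1 + 2 * ellDelta ψ ^ 2) / (4 * ellDelta ψ ^ 3))
        + m * (3 * sin ψ ^ 2 * (1 + 2 * ellDelta ψ ^ 2) / (8 * ellDelta ψ ^ 3))) =
      (2 * ellipticE (√3 / 2) + ellipticK (√3 / 2)) / 6 := by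
  have h1 : ∀ k : ℝ, ∫ s in (0 : ℝ)..1, s ^ 2 * k = k / 3 := fun k => by
    rw [intervalIntegral.integral_mul_const, integral_pow]; norm_num; ring
  have h2 : ∀ k l : ℝ, ∫ m in (0 : ℝ)..1, ((1 - m) * k + m * l) / 3 = (k + l) / 6 := fun k l => by
    rw [intervalIntegral.integral_div, intervalIntegral.integral_add
      (Continuous.intervalIntegrable (by fun_prop) _ _)
      (Continuous.intervalIntegrable (by fun_prop) _ _), intervalIntegral.integral_mul_const,
      intervalIntegral.integral_mul_const]
    norm_num [integral_id, integral_one_sub]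
    ring
  have h3 : ∀ ψ : ℝ, (3 * cos ψ ^ 2 * (1 + 2 * ellDelta ψ ^ 2) / (4 * ellDelta ψ ^ 3)
      + 3 * sin ψ ^ 2 * (1 + 2 * ellDelta ψ ^ 2) / (8 * ellDelta ψ ^ 3)) / 6
      = 1 / 24 * (1 / ellDelta ψ ^ 3) + (1 / 6 * (1 / ellDelta ψ ^ 1) + 1 / 6 * ellDelta ψ) := by
    intro ψ
    have h0 := ellDelta_ne_zero ψ
    have h1 := ellDelta_sq ψ
    have hs := sin_sq_add_cos_sq ψ
    have e1 : cos ψ ^ 2 = (4 * ellDelta ψ ^ 2 - 1) / 3 := by linarith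
    have e2 : sin ψ ^ 2 = 4 * (1 - ellDelta ψ ^ 2) / 3 := by linarith
    rw [e1, e2]
    field_simp
    ring
  have i1 := (intervalIntegrable_inv_ellDelta_pow 1 0 (π / 2)).const_mul (1 / 6)
  have i3 := (intervalIntegrable_inv_ellDelta_pow 3 0 (π / 2)).const_mul (1 / 24)
  have i0 : IntervalIntegrable (fun ψ => 1 / 6 * ellDelta ψ) volume 0 (π / 2) :=
    (continuous_const.mul continuous_ellDelta).intervalIntegrable _ _
  simp only [h1, h2, h3]
  rw [intervalIntegral.integral_add i3 (i1.add i0), intervalIntegral.integral_add i1 i0]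
  simp only [intervalIntegral.integral_const_mul, integral_inv_ellDelta_cube, pow_one,
    ← ellipticK_eq, ← ellipticE_eq]
  ring

/-- The volume of the offset of the developable surface in one quadrant. -/
lemma integral_offset : ∫ ψ in (0 : ℝ)..(π / 2), ∫ m in (0 : ℝ)..1, ∫ h in (0 : ℝ)..1,
      ((1 - m) * (3 * cos ψ ^ 2 / ellDelta ψ ^ 2) + m * (3 * sin ψ ^ 2 / (2 * ellDelta ψ ^ 2))
        + h * (3 / (2 * ellDelta ψ))) =
      π + 3 / 4 * ellipticK (√3 / 2) := by
  have h1 : ∀ k l : ℝ, ∫ h in (0 : ℝ)..1, (k + h * l) = k + l / 2 := fun k l => by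
    rw [intervalIntegral.integral_add
      (Continuous.intervalIntegrable (by fun_prop) _ _)
      (Continuous.intervalIntegrable (by fun_prop) _ _), intervalIntegral.integral_mul_const]
    norm_num [integral_id, integral_one_sub]
    ring
  have h2 : ∀ k l j : ℝ, ∫ m in (0 : ℝ)..1, ((1 - m) * k + m * l + j) = (k + l) / 2 + j :=
    fun k l j => by
    rw [intervalIntegral.integral_add
      (Continuous.intervalIntegrable (by fun_prop) _ _)
      (Continuous.intervalIntegrable (by fun_prop) _ _), intervalIntegral.integral_add
      (Continuous.intervalIntegrable (by fun_prop) _ _)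
      (Continuous.intervalIntegrable (by fun_prop) _ _), intervalIntegral.integral_mul_const,
      intervalIntegral.integral_mul_const]
    norm_num [integral_id, integral_one_sub]
    ring
  have h3 : ∀ ψ : ℝ, (3 * cos ψ ^ 2 / ellDelta ψ ^ 2 + 3 * sin ψ ^ 2 / (2 * ellDelta ψ ^ 2)) / 2
      + 3 / (2 * ellDelta ψ) / 2
      = 1 / 2 * (1 / ellDelta ψ ^ 2) + (3 / 4 * (1 / ellDelta ψ ^ 1) + 1) := by
    intro ψ
    have h0 := ellDelta_ne_zero ψ
    have h1 := ellDelta_sq ψ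
    have hs := sin_sq_add_cos_sq ψ
    have e1 : cos ψ ^ 2 = (4 * ellDelta ψ ^ 2 - 1) / 3 := by linarith
    have e2 : sin ψ ^ 2 = 4 * (1 - ellDelta ψ ^ 2) / 3 := by linarith
    rw [e1, e2]
    field_simp
    ring
  have i1 := (intervalIntegrable_inv_ellDelta_pow 1 0 (π / 2)).const_mul (3 / 4)
  have i2 := (intervalIntegrable_inv_ellDelta_pow 2 0 (π / 2)).const_mul (1 / 2)
  have i0 : IntervalIntegrable (fun _ : ℝ => (1 : ℝ)) volume 0 (π / 2) := by simp
  simp only [h1, h2, h3]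
  rw [intervalIntegral.integral_add i2 (i1.add i0), intervalIntegral.integral_add i1 i0]
  simp only [intervalIntegral.integral_const_mul, integral_inv_ellDelta_sq, pow_one,
    ← ellipticK_eq]
  simp
  ring

/-- The largest angle between the plane of the circle `kA` and a normal vector of the oloid at the
point of `kA` with angular coordinate `t`. -/
def tilt (t : ℝ) : ℝ := arctan √(1 + 2 * cos t)

lemma continuous_tilt : Continuous tilt := by
  unfold tilt
  exact continuous_arctan.comp (by fun_prop)

lemma tilt_nonneg (t : ℝ) : 0 ≤ tilt t := arctan_nonneg.2 (sqrt_nonneg _)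

lemma tilt_lt (t : ℝ) : tilt t < π / 2 := arctan_lt_pi_div_two _

lemma cos_two_pi_div_three : cos (2 * π / 3) = -1 / 2 := by
  rw [show 2 * π / 3 = π - π / 3 by ring, cos_pi_sub, cos_pi_div_three]; ring

lemma one_add_two_cos_pos {t : ℝ} (h0 : 0 ≤ t) (h1 : t < 2 * π / 3) : 0 < 1 + 2 * cos t := by
  have := cos_lt_cos_of_nonneg_of_le_pi h0 (by linarith [pi_pos] : 2 * π / 3 ≤ π) h1
  rw [cos_two_pi_div_three] at this
  linarith

lemma cos_two_tilt {t : ℝ} (h : 0 ≤ 1 + 2 * cos t) :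
    cos (2 * tilt t) = -(cos t / (1 + cos t)) := by
  have h1 : 1 + cos t ≠ 0 := by linarith
  rw [cos_two_mul, tilt, cos_sq_arctan, sq_sqrt h]
  have : 1 + (1 + 2 * cos t) ≠ 0 := by linarith
  field_simp
  ring

lemma two_tilt_two_tilt {t : ℝ} (h0 : 0 < t) (h1 : t < 2 * π / 3) :
    2 * tilt (2 * tilt t) = t := by
  have hp := one_add_two_cos_pos h0.le h1
  have h2 : 1 + 2 * cos (2 * tilt t) = tan (t / 2) ^ 2 := by
    have hc : 0 < cos (t / 2) := cos_pos_of_mem_Ioo ⟨by linarith [pi_pos], by linarith [pi_pos]⟩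
    have e : cos t = 2 * cos (t / 2) ^ 2 - 1 := by rw [← cos_two_mul]; ring_nf
    have hs := sin_sq_add_cos_sq (t / 2)
    rw [cos_two_tilt hp.le, tan_eq_sin_div_cos, div_pow, e]
    have : sin (t / 2) ^ 2 = 1 - cos (t / 2) ^ 2 := by linarith
    rw [this]
    have : 1 + (2 * cos (t / 2) ^ 2 - 1) ≠ 0 := by
      have := pow_pos hc 2
      linarith
    field_simp
    ring
  have h3 : 0 ≤ tan (t / 2) :=
    tan_nonneg_of_nonneg_of_le_pi_div_two (by linarith) (by linarith [pi_pos])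
  rw [tilt, h2, sqrt_sq h3, arctan_tan (by linarith [pi_pos]) (by linarith [pi_pos])]
  ring

lemma differentiableAt_tilt {t : ℝ} (h : 0 < 1 + 2 * cos t) : DifferentiableAt ℝ tilt t := by
  have := h.ne'
  unfold tilt
  exact DifferentiableAt.arctan (DifferentiableAt.sqrt (by fun_prop) this)

lemma constI_eq : constI = π ^ 2 / 2 - ∫ t in (0 : ℝ)..(π / 2), 2 * tilt t := by
  have hi : IntervalIntegrable (fun t => 2 * tilt t) volume 0 (π / 2) :=
    (continuous_const.mul continuous_tilt).intervalIntegrable _ _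
  have h : ∫ t in (0 : ℝ)..(π / 2), (π - 2 * tilt t) = constI := by
    refine intervalIntegral.integral_congr fun t ht => ?_
    rw [Set.uIcc_of_le (by positivity)] at ht
    have hc : 0 ≤ cos t := cos_nonneg_of_mem_Icc ⟨by linarith [ht.1, pi_pos], ht.2⟩
    have e := cos_two_tilt (t := t) (by linarith)
    change π - 2 * tilt t = arccos (cos t / (1 + cos t))
    rw [show cos t / (1 + cos t) = -cos (2 * tilt t) by rw [e]; ring, arccos_neg,
      arccos_cos (by linarith [tilt_nonneg t]) (by linarith [tilt_lt t])]
  rw [← h, intervalIntegral.integral_sub (by simp) hi]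
  simp
  ring

lemma integral_two_tilt :
    ∫ t in (0 : ℝ)..(2 * π / 3), 2 * tilt t = 3 * π ^ 2 / 4 - 2 * constI := by
  have hcont : Continuous fun t => 2 * tilt t := continuous_const.mul continuous_tilt
  set P : ℝ → ℝ := fun x => ∫ t in (0 : ℝ)..x, 2 * tilt t with hP
  have hPd : ∀ x, HasDerivAt P (2 * tilt x) x := fun x => hcont.integral_hasStrictDerivAt 0 x
    |>.hasDerivAt
  have hPc : Continuous P := continuous_iff_continuousAt.2 fun x => (hPd x).continuousAt
  have hd : ∀ t ∈ Set.Ioo (π / 2) (2 * π / 3),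
      HasDerivAt (fun t => P t - t * (2 * tilt t) + P (2 * tilt t)) 0 t := by
    intro t ht
    have ht0 : 0 < t := lt_trans (by positivity) ht.1
    have h1 := ((differentiableAt_tilt (one_add_two_cos_pos ht0.le ht.2)).hasDerivAt).const_mul 2
    have h2 := (((hPd t).sub ((hasDerivAt_id t).mul h1)).add ((hPd (2 * tilt t)).comp t h1))
    refine h2.congr_deriv ?_
    rw [two_tilt_two_tilt ht0 ht.2]
    simp
  have h := intervalIntegral.integral_eq_sub_of_hasDerivAt_of_le
    (by linarith [pi_pos] : π / 2 ≤ 2 * π / 3)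
    (Continuous.continuousOn (by fun_prop (disch := assumption))) hd (by simp)
  have e1 : tilt (2 * π / 3) = 0 := by rw [tilt, cos_two_pi_div_three]; norm_num
  have e2 : 2 * tilt (π / 2) = π / 2 := by rw [tilt]; simp; ring
  have e3 : P 0 = 0 := by simp [hP]
  rw [e2, e1] at h
  simp only [mul_zero, e3, intervalIntegral.integral_zero] at h
  change P (2 * π / 3) = _
  rw [constI_eq]
  change _ = 3 * π ^ 2 / 4 - 2 * (π ^ 2 / 2 - P (π / 2))
  linarith

lemma integral_sin_tilt : ∫ t in (0 : ℝ)..(2 * π / 3), sin (tilt t) = π / 2 := by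
  have h3 : (√3 : ℝ) ^ 2 = 3 := sq_sqrt (by norm_num)
  have h3p : (0 : ℝ) < √3 := by positivity
  have hcos : ∀ t ∈ Set.Icc 0 (2 * π / 3), 0 < cos (t / 2) := fun t ht =>
    cos_pos_of_mem_Ioo ⟨by linarith [pi_pos, ht.1], by linarith [pi_pos, ht.2]⟩
  have hd : ∀ t ∈ Set.Ioo 0 (2 * π / 3), HasDerivAt
      (fun t => 2 * arcsin (2 * sin (t / 2) / √3) - arcsin (tan (t / 2) / √3))
      (sin (tilt t)) t := by
    intro t ht
    have hc := hcos t ⟨ht.1.le, ht.2.le⟩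
    have hp := one_add_two_cos_pos ht.1.le ht.2
    have hs := sin_sq_add_cos_sq (t / 2)
    have e : cos t = 2 * cos (t / 2) ^ 2 - 1 := by rw [← cos_two_mul]; ring_nf
    set κ := cos (t / 2) with hκ
    set σ := sin (t / 2) with hσ
    have hq : 0 < 4 * κ ^ 2 - 1 := by rw [e] at hp; linarith
    set q := √(4 * κ ^ 2 - 1) with hqd
    have hq0 : 0 < q := sqrt_pos.2 hq
    have hq2 : q ^ 2 = 4 * κ ^ 2 - 1 := sq_sqrt hq.le
    have r1 : √(1 - (2 * σ / √3) ^ 2) = q / √3 := by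
      rw [sqrt_eq_iff_mul_self_eq (by
        rw [div_pow, h3, sub_nonneg, div_le_one (by norm_num)]; nlinarith) (by positivity)]
      rw [div_pow, h3, div_mul_div_comm, ← sq, ← sq, h3, hq2]
      nlinarith
    have ht2 : tan (t / 2) = σ / κ := tan_eq_sin_div_cos _
    have r2 : √(1 - (tan (t / 2) / √3) ^ 2) = q / (√3 * κ) := by
      have : 1 - (tan (t / 2) / √3) ^ 2 = (q / (√3 * κ)) ^ 2 := by
        rw [ht2]
        have : σ ^ 2 = 1 - κ ^ 2 := by linarith
        simp only [div_pow, mul_pow, h3, hq2, this]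
        field_simp
        ring
      rw [this, sqrt_sq (by positivity)]
    have n1 : 0 < √(1 - (2 * σ / √3) ^ 2) := by rw [r1]; positivity
    have n2 : 0 < √(1 - (tan (t / 2) / √3) ^ 2) := by rw [r2]; positivity
    rw [sqrt_pos] at n1 n2
    have hh : HasDerivAt (fun t : ℝ => t / 2) (1 / 2) t := (hasDerivAt_id t).div_const 2
    have d1 := (hasDerivAt_arcsin (x := 2 * σ / √3) (by rintro h; rw [h] at n1; norm_num at n1)
      (by rintro h; rw [h] at n1; norm_num at n1)).comp t ((hh.sin.const_mul 2).div_const √3)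
    have d2 := (hasDerivAt_arcsin (x := tan (t / 2) / √3)
      (by rintro h; rw [h] at n2; norm_num at n2)
      (by rintro h; rw [h] at n2; norm_num at n2)).comp t
        (((hasDerivAt_tan hc.ne').comp t hh).div_const √3)
    refine ((d1.const_mul 2).sub d2).congr_deriv ?_
    rw [r1, r2, tilt, sin_arctan, sq_sqrt hp.le, e]
    rw [show 1 + 2 * (2 * κ ^ 2 - 1) = 4 * κ ^ 2 - 1 by ring, ← hqd,
      show 1 + (4 * κ ^ 2 - 1) = (2 * κ) ^ 2 by ring, sqrt_sq (by positivity)]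
    rw [← hκ]
    field_simp
    rw [hq2]
    ring
  have hcont : ContinuousOn
      (fun t => 2 * arcsin (2 * sin (t / 2) / √3) - arcsin (tan (t / 2) / √3))
      (Set.Icc 0 (2 * π / 3)) := by
    refine ContinuousOn.sub (Continuous.continuousOn ?_) ?_
    · exact continuous_const.mul (continuous_arcsin.comp (by fun_prop))
    · refine continuous_arcsin.comp_continuousOn (ContinuousOn.div_const ?_ _)
      exact fun t ht => (ContinuousAt.comp (f := fun t : ℝ => t / 2) (continuousAt_tan.2
        (hcos t ht).ne') (by fun_prop)).continuousWithinAt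
  rw [intervalIntegral.integral_eq_sub_of_hasDerivAt_of_le (by positivity) hcont hd
    ((continuous_sin.comp continuous_tilt).intervalIntegrable _ _),
    show 2 * π / 3 / 2 = π / 3 by ring, sin_pi_div_three, tan_pi_div_three,
    show 2 * (√3 / 2) / √3 = 1 by field_simp, div_self h3p.ne']
  simp
  ring

/-- The volume of the points of one quadrant of the parallel body whose nearest point in the oloid
lies on the circle `kA`. -/
lemma integral_edge : ∫ t in (0 : ℝ)..(2 * π / 3), ∫ φ in (0 : ℝ)..tilt t, ∫ ρ in (0 : ℝ)..1,
      ρ * (1 + ρ * cos φ) = 3 * π ^ 2 / 16 - constI / 2 + π / 6 := by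
  have h1 : ∀ k : ℝ, ∫ ρ in (0 : ℝ)..1, ρ * (1 + ρ * k) = 1 / 2 + k / 3 := fun k => by
    have : ∀ ρ : ℝ, ρ * (1 + ρ * k) = ρ + ρ ^ 2 * k := fun ρ => by ring
    simp only [this]
    rw [intervalIntegral.integral_add
      (Continuous.intervalIntegrable (by fun_prop) _ _)
      (Continuous.intervalIntegrable (by fun_prop) _ _), intervalIntegral.integral_mul_const,
      integral_pow]
    norm_num [integral_id]
    ring
  have h2 : ∀ b : ℝ, ∫ φ in (0 : ℝ)..b, (1 / 2 + cos φ / 3) = 1 / 4 * (2 * b) + 1 / 3 * sin b :=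
    fun b => by
    rw [intervalIntegral.integral_add
      (Continuous.intervalIntegrable (by fun_prop) _ _)
      (Continuous.intervalIntegrable (by fun_prop) _ _)]
    simp
    ring
  have c1 := continuous_tilt
  simp only [h1, h2]
  rw [intervalIntegral.integral_add
      (Continuous.intervalIntegrable (by fun_prop) _ _)
      (Continuous.intervalIntegrable (by fun_prop) _ _),
      intervalIntegral.integral_const_mul (1 / 4),
      intervalIntegral.integral_const_mul (1 / 3), integral_two_tilt, integral_sin_tilt]
  ring

lemma E3.ext {p q : E3} (h0 : p 0 = q 0) (h1 : p 1 = q 1) (h2 : p 2 = q 2) : p = q := by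
  ext i; fin_cases i <;> assumption

lemma inner_E3 (p q : E3) : inner ℝ p q = p 0 * q 0 + p 1 * q 1 + p 2 * q 2 := by
  simp [PiLp.inner_apply, Fin.sum_univ_three, mul_comm]

lemma norm_sq_E3 (p : E3) : ‖p‖ ^ 2 = p 0 ^ 2 + p 1 ^ 2 + p 2 ^ 2 := by
  rw [← real_inner_self_eq_norm_sq, inner_E3]; ring

lemma Convex.disk_mem {V : Type*} [AddCommGroup V] [Module ℝ V] {S : Set V} (hS : Convex ℝ S)
    {c e f : V} (h : ∀ X Y : ℝ, X ^ 2 + Y ^ 2 = 1 → c + X • e + Y • f ∈ S) {X Y : ℝ}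
    (hXY : X ^ 2 + Y ^ 2 ≤ 1) : c + X • e + Y • f ∈ S := by
  set w := √(1 - Y ^ 2) with hw
  have hw2 : w ^ 2 = 1 - Y ^ 2 := sq_sqrt (by nlinarith)
  have hXw := abs_le_of_sq_le_sq' (by linarith : X ^ 2 ≤ w ^ 2) (sqrt_nonneg _)
  rcases (sqrt_nonneg (1 - Y ^ 2)).eq_or_lt with h0 | h0
  · have h0' : w = 0 := h0.symm
    exact h X Y (by nlinarith)
  · have h1 := h w Y (by linarith)
    have h2 := h (-w) Y (by linarith)
    rw [← hw] at h0
    convert hS h1 h2 (a := (w + X) / (2 * w)) (b := (w - X) / (2 * w))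
      (div_nonneg (by linarith) (by linarith)) (div_nonneg (by linarith) (by linarith))
      (by field_simp; ring) using 1
    have e1 : (w + X) / (2 * w) = 1 - (w - X) / (2 * w) := by field_simp; ring
    have e2 : X = w - 2 * w * ((w - X) / (2 * w)) := by field_simp; ring
    rw [e1]
    generalize (w - X) / (2 * w) = k at e2
    rw [e2]
    module

/-- The point of the oloid dividing the segment between the point of the disk bounded by `kA` with
coordinates `X`, `Y` and the point of the disk bounded by `kB` with coordinates `Z`, `W`. -/
def joinPt (m X Y Z W : ℝ) : E3 := !₂[(1 - m) * X, (1 - m) * (Y - 1 / 2) + m * (W + 1 / 2), m * Z]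

lemma sq_add_sq_combo_le {a b X Y X' Y' : ℝ} (ha : 0 ≤ a) (hb : 0 ≤ b) (hab : a + b = 1)
    (h : X ^ 2 + Y ^ 2 ≤ 1) (h' : X' ^ 2 + Y' ^ 2 ≤ 1) :
    (a * X + b * X') ^ 2 + (a * Y + b * Y') ^ 2 ≤ 1 := by
  obtain rfl : b = 1 - a := by linarith
  nlinarith [mul_nonneg (mul_nonneg ha hb) (add_nonneg (sq_nonneg (X - X')) (sq_nonneg (Y - Y'))),
    mul_le_mul_of_nonneg_left h ha, mul_le_mul_of_nonneg_left h' hb]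

lemma mem_oloid_iff {p : E3} : p ∈ oloid ↔ ∃ m X Y Z W, m ∈ Set.Icc (0 : ℝ) 1 ∧
    X ^ 2 + Y ^ 2 ≤ 1 ∧ Z ^ 2 + W ^ 2 ≤ 1 ∧ p = joinPt m X Y Z W := by
  constructor
  · intro hp
    have hA : kA.Nonempty := ⟨!₂[1, -1 / 2, 0], by simp [kA]; norm_num⟩
    have hB : kB.Nonempty := ⟨!₂[0, 1 / 2, 1], by simp [kB]⟩
    rw [oloid, convexHull_union hA hB, mem_convexJoin] at hp
    obtain ⟨a, ha, b, hb, hp⟩ := hp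
    have ha' : a ∈ {p : E3 | p 0 ^ 2 + (p 1 + 1 / 2) ^ 2 ≤ 1 ∧ p 2 = 0} := by
      refine convexHull_min (s := kA) (t := {p : E3 | _}) ?_ ?_ ha
      · rintro q hq
        exact ⟨hq.1.le, hq.2⟩
      intro q hq q' hq' s t hs ht hst
      refine ⟨?_, by simp [hq.2, hq'.2]⟩
      have h := sq_add_sq_combo_le hs ht hst hq.1 hq'.1
      rw [show s * (q 1 + 1 / 2) + t * (q' 1 + 1 / 2) = s * q 1 + t * q' 1 + 1 / 2 by
        linear_combination (1 / 2) * hst] at h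
      exact h
    have hb' : b ∈ {p : E3 | p 2 ^ 2 + (p 1 - 1 / 2) ^ 2 ≤ 1 ∧ p 0 = 0} := by
      refine convexHull_min (s := kB) (t := {p : E3 | _}) ?_ ?_ hb
      · rintro q hq
        exact ⟨by rw [add_comm]; exact hq.1.le, hq.2⟩
      intro q hq q' hq' s t hs ht hst
      refine ⟨?_, by simp [hq.2, hq'.2]⟩
      have h := sq_add_sq_combo_le hs ht hst hq.1 hq'.1
      rw [show s * (q 1 - 1 / 2) + t * (q' 1 - 1 / 2) = s * q 1 + t * q' 1 - 1 / 2 by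
        linear_combination (-1 / 2) * hst] at h
      exact h
    obtain ⟨s, m, hs, hm, hsm, rfl⟩ := hp
    obtain rfl : s = 1 - m := by linarith
    refine ⟨m, a 0, a 1 + 1 / 2, b 2, b 1 - 1 / 2, ⟨hm, by linarith⟩, ha'.1, hb'.1, ?_⟩
    apply E3.ext
    · simp [joinPt, hb'.2]
    · simp [joinPt]
    · simp [joinPt, ha'.2]
  · rintro ⟨m, X, Y, Z, W, hm, h1, h2, rfl⟩
    have hc : Convex ℝ oloid := convex_convexHull ℝ _
    have a := hc.disk_mem (c := !₂[0, -1 / 2, 0]) (e := !₂[1, 0, 0]) (f := !₂[0, 1, 0])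
      (fun X Y h => subset_convexHull ℝ _ <| Or.inl <| by
        simp only [kA, Set.mem_ofPred_eq]
        simp
        ring_nf
        exact h) h1
    have b := hc.disk_mem (c := !₂[0, 1 / 2, 0]) (e := !₂[0, 0, 1]) (f := !₂[0, 1, 0])
      (fun X Y h => subset_convexHull ℝ _ <| Or.inr <| by
        simp only [kB, Set.mem_ofPred_eq]
        simp
        linarith) h2
    convert hc a b (sub_nonneg.2 hm.2) hm.1 (by ring) using 1
    apply E3.ext <;> simp [joinPt] <;> ring

lemma convex_oloid : Convex ℝ oloid := convex_convexHull ℝ _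

lemma isCompact_oloid : IsCompact oloid := by
  have hd : IsCompact {x : ℝ × ℝ | x.1 ^ 2 + x.2 ^ 2 ≤ 1} := by
    refine (isCompact_Icc (a := ((-1 : ℝ), (-1 : ℝ))) (b := (1, 1))).of_isClosed_subset
      (isClosed_le (by fun_prop) (by fun_prop)) fun x hx => ?_
    have hx' : x.1 ^ 2 + x.2 ^ 2 ≤ 1 := hx
    exact ⟨⟨by change -1 ≤ x.1; nlinarith [sq_nonneg x.2],
      by change -1 ≤ x.2; nlinarith [sq_nonneg x.1]⟩,
      ⟨by change x.1 ≤ 1; nlinarith [sq_nonneg x.2], by change x.2 ≤ 1; nlinarith [sq_nonneg x.1]⟩⟩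
  have hK := (isCompact_Icc (a := (0 : ℝ)) (b := 1)).prod (hd.prod hd)
  have hcont : Continuous fun x : ℝ × (ℝ × ℝ) × (ℝ × ℝ) =>
      joinPt x.1 x.2.1.1 x.2.1.2 x.2.2.1 x.2.2.2 := by
    refine (PiLp.continuous_toLp 2 _).comp (continuous_pi fun i => ?_)
    fin_cases i <;> simp <;> fun_prop
  convert hK.image hcont using 1
  ext p
  rw [mem_oloid_iff]
  constructor
  · rintro ⟨m, X, Y, Z, W, hm, h1, h2, rfl⟩
    exact ⟨(m, (X, Y), (Z, W)), ⟨hm, h1, h2⟩, rfl⟩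
  · rintro ⟨⟨m, ⟨X, Y⟩, ⟨Z, W⟩⟩, ⟨hm, h1, h2⟩, rfl⟩
    exact ⟨m, X, Y, Z, W, hm, h1, h2, rfl⟩

/-- The length of the projection of `u` to the plane of `kA`. -/
def radA (u : E3) : ℝ := √(u 0 ^ 2 + u 1 ^ 2)

/-- The length of the projection of `u` to the plane of `kB`. -/
def radB (u : E3) : ℝ := √(u 2 ^ 2 + u 1 ^ 2)

/-- The support function of `kA`. -/
def suppA (u : E3) : ℝ := radA u - u 1 / 2

/-- The support function of `kB`. -/
def suppB (u : E3) : ℝ := radB u + u 1 / 2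

/-- The point dividing in the ratio `m : 1 - m` the segment between the extreme points of `kA` and
`kB` in direction `u`. -/
def facePt (u : E3) (m : ℝ) : E3 :=
  joinPt m (u 0 / radA u) (u 1 / radA u) (u 2 / radB u) (u 1 / radB u)

/-- The vector `u` is an outer normal vector of the oloid at `p`. -/
def IsNormal (u p : E3) : Prop := p ∈ oloid ∧ ∀ q ∈ oloid, inner ℝ q u ≤ inner ℝ p u

lemma inner_joinPt (m X Y Z W : ℝ) (u : E3) : inner ℝ (joinPt m X Y Z W) u =
    (1 - m) * (X * u 0 + Y * u 1 - u 1 / 2) + m * (Z * u 2 + W * u 1 + u 1 / 2) := by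
  simp [inner_E3, joinPt]; ring

lemma mul_add_mul_le_sqrt {X Y a b : ℝ} (h : X ^ 2 + Y ^ 2 ≤ 1) :
    X * a + Y * b ≤ √(a ^ 2 + b ^ 2) := by
  refine le_sqrt_of_sq_le ?_
  nlinarith [sq_nonneg (X * b - Y * a),
    mul_le_mul_of_nonneg_right h (add_nonneg (sq_nonneg a) (sq_nonneg b))]

lemma eq_div_sqrt {X Y a b : ℝ} (h : X ^ 2 + Y ^ 2 ≤ 1) (h0 : 0 < √(a ^ 2 + b ^ 2))
    (he : √(a ^ 2 + b ^ 2) ≤ X * a + Y * b) :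
    X = a / √(a ^ 2 + b ^ 2) ∧ Y = b / √(a ^ 2 + b ^ 2) := by
  set r := √(a ^ 2 + b ^ 2)
  have hr : r ^ 2 = a ^ 2 + b ^ 2 := sq_sqrt (by positivity)
  have key : (X * r - a) ^ 2 + (Y * r - b) ^ 2 ≤ 0 := by
    have h1 := mul_le_mul_of_nonneg_left h (sq_nonneg r)
    have h2 := mul_le_mul_of_nonneg_left he h0.le
    nlinarith
  have e1 : (X * r - a) ^ 2 = 0 := by nlinarith [sq_nonneg (X * r - a), sq_nonneg (Y * r - b)]
  have e2 : (Y * r - b) ^ 2 = 0 := by nlinarith [sq_nonneg (X * r - a), sq_nonneg (Y * r - b)]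
  rw [eq_div_iff h0.ne', eq_div_iff h0.ne']
  exact ⟨by linarith [pow_eq_zero_iff (two_ne_zero) |>.1 e1],
    by linarith [pow_eq_zero_iff (two_ne_zero) |>.1 e2]⟩

lemma div_sq_add_div_sq_le {a b : ℝ} :
    (a / √(a ^ 2 + b ^ 2)) ^ 2 + (b / √(a ^ 2 + b ^ 2)) ^ 2 ≤ 1 := by
  rw [div_pow, div_pow, sq_sqrt (by positivity), ← add_div]
  exact div_self_le_one _

lemma div_mul_add_div_mul {a b : ℝ} :
    a / √(a ^ 2 + b ^ 2) * a + b / √(a ^ 2 + b ^ 2) * b = √(a ^ 2 + b ^ 2) := by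
  rw [div_mul_eq_mul_div, div_mul_eq_mul_div, ← add_div, ← sq, ← sq, div_sqrt]

lemma facePt_mem (u : E3) {m : ℝ} (hm : m ∈ Set.Icc (0 : ℝ) 1) : facePt u m ∈ oloid :=
  mem_oloid_iff.2 ⟨m, _, _, _, _, hm, div_sq_add_div_sq_le, div_sq_add_div_sq_le, rfl⟩

lemma inner_facePt (u : E3) (m : ℝ) :
    inner ℝ (facePt u m) u = (1 - m) * suppA u + m * suppB u := by
  rw [facePt, inner_joinPt, radA, radB, div_mul_add_div_mul, div_mul_add_div_mul]; rfl

lemma inner_le_max {q : E3} (hq : q ∈ oloid) (u : E3) :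
    inner ℝ q u ≤ max (suppA u) (suppB u) := by
  obtain ⟨m, X, Y, Z, W, hm, h1, h2, rfl⟩ := mem_oloid_iff.1 hq
  rw [inner_joinPt]
  have a : X * u 0 + Y * u 1 - u 1 / 2 ≤ max (suppA u) (suppB u) :=
    le_max_of_le_left (sub_le_sub_right (mul_add_mul_le_sqrt h1) _)
  have b : Z * u 2 + W * u 1 + u 1 / 2 ≤ max (suppA u) (suppB u) :=
    le_max_of_le_right (add_le_add_left (mul_add_mul_le_sqrt h2) _)
  nlinarith [mul_le_mul_of_nonneg_left a (sub_nonneg.2 hm.2), mul_le_mul_of_nonneg_left b hm.1]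

lemma isNormal_facePt {u : E3} {m : ℝ} (hm : m ∈ Set.Icc (0 : ℝ) 1)
    (h : max (suppA u) (suppB u) ≤ (1 - m) * suppA u + m * suppB u) : IsNormal u (facePt u m) :=
  ⟨facePt_mem u hm, fun q hq => (inner_le_max hq u).trans (by rwa [inner_facePt])⟩

lemma IsNormal.suppA_le {u p : E3} (h : IsNormal u p) : suppA u ≤ inner ℝ p u := by
  simpa [inner_facePt] using h.2 _ (facePt_mem u (m := 0) (by simp))

lemma IsNormal.suppB_le {u p : E3} (h : IsNormal u p) : suppB u ≤ inner ℝ p u := by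
  simpa [inner_facePt] using h.2 _ (facePt_mem u (m := 1) (by simp))

lemma norm_le_radA_add_radB (u : E3) : ‖u‖ ≤ radA u + radB u := by
  have h0 : 0 ≤ radA u + radB u := add_nonneg (sqrt_nonneg _) (sqrt_nonneg _)
  refine abs_le_of_sq_le_sq' ?_ h0 |>.2
  have h1 : radA u ^ 2 = u 0 ^ 2 + u 1 ^ 2 := sq_sqrt (by positivity)
  have h2 : radB u ^ 2 = u 2 ^ 2 + u 1 ^ 2 := sq_sqrt (by positivity)
  have h3 : 0 ≤ radA u * radB u := mul_nonneg (sqrt_nonneg _) (sqrt_nonneg _)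
  rw [norm_sq_E3]
  nlinarith [sq_nonneg (u 1)]

lemma IsNormal.half_norm_le {u p : E3} (h : IsNormal u p) : ‖u‖ / 2 ≤ inner ℝ p u := by
  have h1 := h.suppA_le
  have h2 := h.suppB_le
  have h3 := norm_le_radA_add_radB u
  rw [suppA] at h1
  rw [suppB] at h2
  linarith

lemma IsNormal.exists_facePt {u p : E3} (hu : u ≠ 0) (h : IsNormal u p) :
    ∃ m ∈ Set.Icc (0 : ℝ) 1, p = facePt u m ∧ (suppA u < suppB u → m = 1) ∧
      (suppB u < suppA u → m = 0) := by
  have hpos : 0 < inner ℝ p u := lt_of_lt_of_le (by positivity) h.half_norm_le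
  have hA := h.suppA_le
  have hB := h.suppB_le
  obtain ⟨m, X, Y, Z, W, hm, h1, h2, rfl⟩ := mem_oloid_iff.1 h.1
  set M := inner ℝ (joinPt m X Y Z W) u with hM
  have hM' := inner_joinPt m X Y Z W u
  rw [← hM] at hM'
  have a : X * u 0 + Y * u 1 ≤ radA u := mul_add_mul_le_sqrt h1
  have b : Z * u 2 + W * u 1 ≤ radB u := mul_add_mul_le_sqrt h2
  have a' : 0 ≤ M - (X * u 0 + Y * u 1 - u 1 / 2) := by rw [suppA] at hA; linarith
  have b' : 0 ≤ M - (Z * u 2 + W * u 1 + u 1 / 2) := by rw [suppB] at hB; linarith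
  have a'' := mul_nonneg (sub_nonneg.2 hm.2) a'
  have b'' := mul_nonneg hm.1 b'
  have ea : m = 1 ∨ suppA u = M ∧ X = u 0 / radA u ∧ Y = u 1 / radA u := by
    have : (1 - m) * (M - (X * u 0 + Y * u 1 - u 1 / 2)) = 0 := by linarith
    rcases mul_eq_zero.1 this with h0 | h0
    · left; linarith
    · right
      have e : suppA u = M := le_antisymm hA (by rw [suppA]; linarith)
      refine ⟨e, eq_div_sqrt h1 ?_ (by rw [← radA]; rw [suppA] at hA; linarith)⟩
      rw [← radA]
      refine lt_of_le_of_ne (sqrt_nonneg _) fun h00 => ?_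
      have h01 : √(u 0 ^ 2 + u 1 ^ 2) = 0 := h00.symm
      rw [sqrt_eq_zero (by positivity)] at h01
      have : u 1 = 0 := by nlinarith [sq_nonneg (u 0), sq_nonneg (u 1)]
      rw [suppA, this, ← h00] at e
      linarith
  have eb : m = 0 ∨ suppB u = M ∧ Z = u 2 / radB u ∧ W = u 1 / radB u := by
    have : m * (M - (Z * u 2 + W * u 1 + u 1 / 2)) = 0 := by linarith
    rcases mul_eq_zero.1 this with h0 | h0
    · left; linarith
    · right
      have e : suppB u = M := le_antisymm hB (by rw [suppB]; linarith)
      refine ⟨e, eq_div_sqrt h2 ?_ (by rw [← radB]; rw [suppB] at hB; linarith)⟩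
      rw [← radB]
      refine lt_of_le_of_ne (sqrt_nonneg _) fun h00 => ?_
      have h01 : √(u 2 ^ 2 + u 1 ^ 2) = 0 := h00.symm
      rw [sqrt_eq_zero (by positivity)] at h01
      have : u 1 = 0 := by nlinarith [sq_nonneg (u 2), sq_nonneg (u 1)]
      rw [suppB, this, ← h00] at e
      linarith
  refine ⟨m, hm, ?_, fun hlt => ?_, fun hlt => ?_⟩
  · rw [facePt]
    rcases ea with rfl | ⟨-, rfl, rfl⟩ <;> rcases eb with h0 | ⟨-, rfl, rfl⟩
    · norm_num at h0
    · simp [joinPt]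
    · subst h0; simp [joinPt]
    · rfl
  · exact ea.resolve_right fun h0 => by linarith [h0.1]
  · exact eb.resolve_right fun h0 => by linarith [h0.1]

lemma exists_isNormal_of_notMem {x : E3} (hx : x ∉ oloid) : ∃ p u : E3, ∃ h : ℝ, ‖u‖ = 1 ∧ 0 < h ∧
    (∀ q ∈ oloid, h ≤ dist q x) ∧ IsNormal u p ∧ x = p + h • u := by
  obtain ⟨p, hp, hmin⟩ := exists_norm_eq_iInf_of_complete_convex
    ⟨_, facePt_mem 0 (m := 0) (by simp)⟩ isCompact_oloid.isComplete convex_oloid x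
  have hn := (norm_eq_iInf_iff_real_inner_le_zero convex_oloid hp).1 hmin
  have hne : x - p ≠ 0 := fun h => hx (by rwa [sub_eq_zero.1 h])
  have hpos : 0 < ‖x - p‖ := norm_pos_iff.2 hne
  refine ⟨p, ‖x - p‖⁻¹ • (x - p), ‖x - p‖, ?_, hpos, fun q hq => ?_, ⟨hp, fun q hq => ?_⟩, ?_⟩
  · rw [norm_smul, norm_inv, norm_norm, inv_mul_cancel₀ hpos.ne']
  · rw [dist_comm, dist_eq_norm, hmin]
    exact ciInf_le ⟨0, Set.forall_mem_range.2 fun _ => norm_nonneg _⟩ (⟨q, hq⟩ : oloid)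
  · rw [← sub_nonpos, ← inner_sub_left, real_inner_smul_right, real_inner_comm]
    exact mul_nonpos_of_nonneg_of_nonpos (by positivity) (hn q hq)
  · rw [smul_smul, mul_inv_cancel₀ hpos.ne', one_smul, add_sub_cancel]

lemma ball_subset_oloid : Metric.ball (0 : E3) (1 / 2) ⊆ oloid := by
  intro q hq
  by_contra hqo
  obtain ⟨p, u, h, hu, hh, -, hn, rfl⟩ := exists_isNormal_of_notMem hqo
  have h1 := hn.half_norm_le
  have h2 := real_inner_le_norm (p + h • u) u
  rw [inner_add_left, real_inner_smul_left, real_inner_self_eq_norm_sq, hu] at h2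
  rw [mem_ball_zero_iff] at hq
  rw [hu] at h1
  linarith

lemma IsNormal.add_notMem {u p : E3} (hn : IsNormal u p) (hu : ‖u‖ = 1) {h : ℝ} (hh : 0 < h) :
    p + h • u ∉ oloid := fun hm => by
  have := hn.2 _ hm
  rw [inner_add_left, real_inner_smul_left, real_inner_self_eq_norm_sq, hu] at this
  linarith

lemma IsNormal.eq_of_add_eq {u p u' p' : E3} (hn : IsNormal u p) (hn' : IsNormal u' p')
    (hu : ‖u‖ = 1) (hu' : ‖u'‖ = 1) {h h' : ℝ} (hh : 0 < h) (hh' : 0 < h')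
    (he : p + h • u = p' + h' • u') : p = p' ∧ h = h' ∧ u = u' := by
  have h1 := mul_le_mul_of_nonneg_left (hn.2 p' hn'.1) hh.le
  have h2 := mul_le_mul_of_nonneg_left (hn'.2 p hn.1) hh'.le
  have e : p' - p = h • u - h' • u' := by
    rw [sub_eq_sub_iff_add_eq_add, ← he, add_comm]
  have key : ‖p' - p‖ ^ 2 ≤ 0 := by
    rw [← real_inner_self_eq_norm_sq]
    nth_rw 2 [e]
    simp only [inner_sub_left, inner_sub_right, real_inner_smul_right]
    linarith
  have e2 : p = p' := by
    have : ‖p' - p‖ = 0 := by nlinarith [norm_nonneg (p' - p)]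
    exact (sub_eq_zero.1 (norm_eq_zero.1 this)).symm
  subst e2
  have e3 : h • u = h' • u' := add_left_cancel he
  have e4 : h = h' := by
    have := congrArg norm e3
    rwa [norm_smul, norm_smul, hu, hu', norm_of_nonneg hh.le, norm_of_nonneg hh'.le, mul_one,
      mul_one] at this
  subst e4
  exact ⟨rfl, rfl, smul_right_injective _ hh.ne' e3⟩

lemma exists_isNormal_smul {x : E3} (hx : x ∈ oloid) (hx0 : x ≠ 0) : ∃ p u : E3, ∃ s : ℝ,
    ‖u‖ = 1 ∧ s ∈ Set.Ioc (0 : ℝ) 1 ∧ IsNormal u p ∧ x = s • p := by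
  obtain ⟨R, hR⟩ := isCompact_oloid.isBounded.subset_closedBall (0 : E3)
  have hxn : 0 < ‖x‖ := norm_pos_iff.2 hx0
  have hcont : Continuous fun t : ℝ => t • x := by fun_prop
  set T : Set ℝ := {t | t • x ∈ oloid} ∩ Set.Ici 1 with hT
  have hTc : IsCompact T := by
    refine (isCompact_Icc (a := 1) (b := R / ‖x‖)).of_isClosed_subset
      ((isCompact_oloid.isClosed.preimage hcont).inter isClosed_Ici) fun t ht => ⟨ht.2, ?_⟩
    have h1 := hR ht.1
    have h2 : (1 : ℝ) ≤ t := ht.2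
    rw [mem_closedBall_zero_iff, norm_smul, norm_of_nonneg (by linarith)] at h1
    rwa [le_div_iff₀ hxn]
  obtain ⟨t, ht, hmax⟩ := hTc.exists_isMaxOn ⟨1, by simpa [hT] using hx⟩ continuousOn_id
  have ht1 : (1 : ℝ) ≤ t := ht.2
  have hnot : t • x ∉ interior oloid := by
    intro hi
    have hev : ∀ᶠ s in nhds t, s • x ∈ oloid :=
      hcont.continuousAt.eventually (mem_interior_iff_mem_nhds.1 hi)
    obtain ⟨s, hs, hs'⟩ := ((frequently_gt_nhds t).and_eventually hev).exists
    have : s ≤ t := hmax (a := s) ⟨hs', (ht1.trans hs.le)⟩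
    linarith
  obtain ⟨f, hf0, hf⟩ := geometric_hahn_banach_of_nonempty_interior_point convex_oloid hnot
    ⟨0, mem_interior.2 ⟨_, ball_subset_oloid, Metric.isOpen_ball,
      Metric.mem_ball_self (by norm_num)⟩⟩
  obtain ⟨w, rfl⟩ := (InnerProductSpace.toDual ℝ E3).surjective f
  have hw : w ≠ 0 := by rintro rfl; simp at hf0
  have hwn : 0 < ‖w‖ := norm_pos_iff.2 hw
  simp only [InnerProductSpace.toDual_apply_apply] at hf
  refine ⟨t • x, ‖w‖⁻¹ • w, t⁻¹, ?_, ⟨by positivity, inv_le_one_of_one_le₀ ht1⟩,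
    ⟨ht.1, fun q hq => ?_⟩, ?_⟩
  · rw [norm_smul, norm_inv, norm_norm, inv_mul_cancel₀ hwn.ne']
  · rw [real_inner_smul_right, real_inner_smul_right, real_inner_comm, real_inner_comm _ (t • x)]
    exact mul_le_mul_of_nonneg_left (hf q hq) (by positivity)
  · rw [smul_smul, inv_mul_cancel₀ (by positivity), one_smul]

lemma hasDerivAt_E3 {f g h : ℝ → ℝ} {a b c t : ℝ} (hf : HasDerivAt f a t) (hg : HasDerivAt g b t)
    (hh : HasDerivAt h c t) :
    HasDerivAt (fun s => (!₂[f s, g s, h s] : E3)) !₂[a, b, c] t := by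
  have e : (fun s => (!₂[f s, g s, h s] : E3)) =
      fun s => coords.symm (f s, g s, h s) := rfl
  rw [e]
  exact (coords.symm.toContinuousLinearMap.hasFDerivAt.comp_hasDerivAt t
    (hf.prodMk (hg.prodMk hh)))

lemma differentiable_E3 {V : Type*} [NormedAddCommGroup V] [NormedSpace ℝ V] {f g h : V → ℝ}
    (hf : Differentiable ℝ f) (hg : Differentiable ℝ g) (hh : Differentiable ℝ h) :
    Differentiable ℝ fun x => (!₂[f x, g x, h x] : E3) := by
  have e : (fun s => (!₂[f s, g s, h s] : E3)) =
      fun s => coords.symm (f s, g s, h s) := rfl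
  rw [e]
  exact coords.symm.differentiable.comp (hf.prodMk (hg.prodMk hh))

/-- The `X`-coordinate of the end point in `kA` of a generating segment of the oloid. -/
def segX (ψ : ℝ) : ℝ := √3 * sin ψ * ellDelta ψ
/-- The `Y`-coordinate of the end point in `kA` of a generating segment of the oloid. -/
def segY (ψ : ℝ) : ℝ := 1 - 2 * ellDelta ψ ^ 2
/-- The `Z`-coordinate of the end point in `kB` of a generating segment of the oloid. -/
def segZ (ψ : ℝ) : ℝ := √3 * cos ψ / (2 * ellDelta ψ ^ 2)
/-- The `W`-coordinate of the end point in `kB` of a generating segment of the oloid. -/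
def segW (ψ : ℝ) : ℝ := 1 / (2 * ellDelta ψ ^ 2) - 1

/-- The points of the generating segments of the oloid. -/
def segPt (ψ m : ℝ) : E3 := joinPt m (segX ψ) (segY ψ) (segZ ψ) (segW ψ)

/-- The outer unit normal vector of the oloid along a generating segment. -/
def segNormal (ψ : ℝ) : E3 :=
  !₂[√3 / 2 * sin ψ, 1 / (2 * ellDelta ψ) - ellDelta ψ, √3 * cos ψ / (2 * ellDelta ψ)]

lemma sqrt_three_sq : (√3 : ℝ) ^ 2 = 3 := sq_sqrt (by norm_num)

lemma sin_sq_eq_ellDelta (ψ : ℝ) : sin ψ ^ 2 = 4 / 3 * (1 - ellDelta ψ ^ 2) := by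
  rw [ellDelta_sq]; ring

lemma cos_sq_eq_ellDelta (ψ : ℝ) : cos ψ ^ 2 = (4 * ellDelta ψ ^ 2 - 1) / 3 := by
  rw [ellDelta_sq, cos_sq']; ring

lemma radA_segNormal (ψ : ℝ) : radA (segNormal ψ) = 1 / (2 * ellDelta ψ) := by
  have h := ellDelta_pos ψ
  rw [radA, sqrt_eq_iff_mul_self_eq (by positivity) (by positivity)]
  have := sin_sq_eq_ellDelta ψ
  simp only [segNormal, PiLp.toLp_apply, Matrix.cons_val_zero, Matrix.cons_val_one]
  rw [mul_pow, div_pow, sqrt_three_sq, this]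
  field_simp
  ring

lemma radB_segNormal (ψ : ℝ) : radB (segNormal ψ) = ellDelta ψ := by
  have h := ellDelta_pos ψ
  rw [radB, sqrt_eq_iff_mul_self_eq (by positivity) (by positivity)]
  have := cos_sq_eq_ellDelta ψ
  simp only [segNormal, PiLp.toLp_apply, Matrix.cons_val]
  rw [div_pow, mul_pow, sqrt_three_sq, this]
  field_simp
  ring

lemma facePt_segNormal (ψ m : ℝ) : facePt (segNormal ψ) m = segPt ψ m := by
  have h := ellDelta_ne_zero ψ
  rw [facePt, segPt, radA_segNormal, radB_segNormal]
  simp only [segNormal, PiLp.toLp_apply, Matrix.cons_val]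
  congr 1
  · rw [segX]; field_simp
  · rw [segY]; field_simp
  · rw [segZ]; field_simp
  · rw [segW]; field_simp

lemma norm_segNormal (ψ : ℝ) : ‖segNormal ψ‖ = 1 := by
  have h := ellDelta_ne_zero ψ
  rw [← sq_eq_sq₀ (norm_nonneg _) zero_le_one, norm_sq_E3]
  simp only [segNormal, PiLp.toLp_apply, Matrix.cons_val]
  rw [div_pow, mul_pow, mul_pow, div_pow, sqrt_three_sq, cos_sq_eq_ellDelta, sin_sq_eq_ellDelta]
  field_simp
  ring

lemma segNormal_ne_zero (ψ : ℝ) : segNormal ψ ≠ 0 :=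
  norm_ne_zero_iff.1 (by rw [norm_segNormal]; exact one_ne_zero)

lemma suppA_segNormal (ψ : ℝ) : suppA (segNormal ψ) = suppB (segNormal ψ) := by
  rw [suppA, suppB, radA_segNormal, radB_segNormal]
  simp only [segNormal, PiLp.toLp_apply, Matrix.cons_val]
  ring

lemma isNormal_segPt (ψ : ℝ) {m : ℝ} (hm : m ∈ Set.Icc (0 : ℝ) 1) :
    IsNormal (segNormal ψ) (segPt ψ m) := by
  rw [← facePt_segNormal]
  refine isNormal_facePt hm ?_
  rw [suppA_segNormal, max_self]
  linarith

lemma sin_cos_pos {ψ : ℝ} (h : ψ ∈ Set.Ioo 0 (π / 2)) : 0 < sin ψ ∧ 0 < cos ψ :=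
  ⟨sin_pos_of_pos_of_lt_pi h.1 (by linarith [h.2, pi_pos]),
    cos_pos_of_mem_Ioo ⟨by linarith [h.1, pi_pos], h.2⟩⟩

lemma injOn_sin_Ioo {ψ ψ' : ℝ} (h : ψ ∈ Set.Ioo 0 (π / 2)) (h' : ψ' ∈ Set.Ioo 0 (π / 2))
    (e : sin ψ = sin ψ') : ψ = ψ' :=
  injOn_sin ⟨by linarith [h.1, pi_pos], h.2.le⟩ ⟨by linarith [h'.1, pi_pos], h'.2.le⟩ e

lemma segNormal_pos {ψ : ℝ} (h : ψ ∈ Set.Ioo 0 (π / 2)) :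
    0 < segNormal ψ 0 ∧ 0 < segNormal ψ 2 := by
  obtain ⟨h1, h2⟩ := sin_cos_pos h
  have h := ellDelta_pos ψ
  simp only [segNormal, PiLp.toLp_apply, Matrix.cons_val]
  constructor <;> positivity

lemma segPt_pos {ψ m : ℝ} (h : ψ ∈ Set.Ioo 0 (π / 2)) (hm : m ∈ Set.Ioo (0 : ℝ) 1) :
    0 < segPt ψ m 0 ∧ 0 < segPt ψ m 2 := by
  obtain ⟨h1, h2⟩ := sin_cos_pos h
  have h := ellDelta_pos ψ
  have := sub_pos.2 hm.2
  have := hm.1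
  simp only [segPt, joinPt, segX, segZ, PiLp.toLp_apply, Matrix.cons_val]
  constructor <;> positivity

lemma exists_segNormal_eq {u : E3} (hu : ‖u‖ = 1) (h0 : 0 < u 0) (h2 : 0 < u 2)
    (h : suppA u = suppB u) : ∃ ψ ∈ Set.Ioo 0 (π / 2), segNormal ψ = u := by
  have hA : radA u ^ 2 = u 0 ^ 2 + u 1 ^ 2 := sq_sqrt (by positivity)
  have hB : radB u ^ 2 = u 2 ^ 2 + u 1 ^ 2 := sq_sqrt (by positivity)
  have hn := norm_sq_E3 u
  rw [hu] at hn
  have hB0 : 0 < radB u := sqrt_pos.2 (by positivity)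
  have hA0 : 0 < radA u := sqrt_pos.2 (by positivity)
  have hu1 : u 1 = radA u - radB u := by rw [suppA, suppB] at h; linarith
  have hAB : radA u * radB u = 1 / 2 := by rw [hu1] at hn hA hB; nlinarith
  set β := radB u
  have hA' : radA u = 1 / (2 * β) := by field_simp; linarith
  have hβ : 1 / 4 < β ^ 2 := by
    have : radA u < 1 := by nlinarith
    nlinarith
  have hr : 0 < (√3 : ℝ) := by positivity
  have hr2 := sqrt_three_sq
  have hx1 : 2 * u 0 / √3 < 1 := by
    rw [div_lt_one hr]
    nlinarith
  have hx0 : 0 < 2 * u 0 / √3 := by positivity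
  have hψ : arcsin (2 * u 0 / √3) ∈ Set.Ioo 0 (π / 2) :=
    ⟨arcsin_pos.2 hx0, arcsin_lt_pi_div_two.2 hx1⟩
  refine ⟨_, hψ, ?_⟩
  have hc := (sin_cos_pos hψ).2
  have hs := sin_arcsin (by linarith : -1 ≤ 2 * u 0 / √3) hx1.le
  set ψ := arcsin (2 * u 0 / √3)
  have hd : ellDelta ψ = β := by
    rw [← sq_eq_sq₀ (ellDelta_pos ψ).le hB0.le, ellDelta_sq, hs, div_pow, hr2]
    linarith
  have hcs := cos_sq_eq_ellDelta ψ
  rw [hd] at hcs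
  apply E3.ext
  · simp only [segNormal, PiLp.toLp_apply, Matrix.cons_val]
    rw [hs]; field_simp
  · simp only [segNormal, PiLp.toLp_apply, Matrix.cons_val]
    rw [hd, hu1, hA']
  · simp only [segNormal, PiLp.toLp_apply, Matrix.cons_val]
    rw [hd, ← sq_eq_sq₀ (by positivity) h2.le, div_pow, mul_pow, mul_pow, hcs, hr2]
    have : u 2 ^ 2 = 1 - (1 / (2 * β)) ^ 2 := by rw [← hA']; linarith
    rw [this]
    field_simp
    ring

lemma segNormal_injOn : Set.InjOn segNormal (Set.Ioo 0 (π / 2)) := fun ψ h ψ' h' e => by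
  have e0 := congrArg (fun u : E3 => u 0) e
  simp only [segNormal, PiLp.toLp_apply, Matrix.cons_val] at e0
  exact injOn_sin_Ioo h h' (mul_left_cancel₀ (by positivity) e0)

lemma segPt_inj_right {ψ m m' : ℝ} (h : ψ ∈ Set.Ioo 0 (π / 2)) (e : segPt ψ m = segPt ψ m') :
    m = m' := by
  have e2 := congrArg (fun u : E3 => u 2) e
  simp only [segPt, joinPt, PiLp.toLp_apply, Matrix.cons_val] at e2
  have := (sin_cos_pos h).2
  have := ellDelta_pos ψ
  exact mul_right_cancel₀ (by rw [segZ]; positivity) e2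

lemma smul_segPt_inj {ψ m s ψ' m' s' : ℝ} (hψ : ψ ∈ Set.Ioo 0 (π / 2))
    (hm : m ∈ Set.Ioo (0 : ℝ) 1) (hs : 0 < s) (hψ' : ψ' ∈ Set.Ioo 0 (π / 2))
    (hm' : m' ∈ Set.Ioo (0 : ℝ) 1) (hs' : 0 < s')
    (e : s • segPt ψ m = s' • segPt ψ' m') : ψ = ψ' ∧ m = m' ∧ s = s' := by
  have hn := isNormal_segPt ψ (Set.Ioo_subset_Icc_self hm)
  have hn' := isNormal_segPt ψ' (Set.Ioo_subset_Icc_self hm')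
  have key : ∀ {u p p' : E3} {s s' : ℝ}, ‖u‖ = 1 → IsNormal u p → p' ∈ oloid → 0 < s → 0 < s' →
      s • p = s' • p' → s ≤ s' := by
    intro u p p' s s' hu hn hp' hs hs' e
    have h1 := hn.half_norm_le
    have h2 := hn.2 _ hp'
    have h3 := congrArg (fun x : E3 => inner ℝ x u) e
    simp only [real_inner_smul_left] at h3
    rw [hu] at h1
    by_contra! hlt
    nlinarith
  have hss : s = s' := le_antisymm (key (norm_segNormal ψ) hn hn'.1 hs hs' e)
    (key (norm_segNormal ψ') hn' hn.1 hs' hs e.symm)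
  subst hss
  have hp : segPt ψ m = segPt ψ' m' := smul_right_injective _ hs.ne' e
  have hA : IsNormal (segNormal ψ) (segPt ψ' 0) := by
    refine ⟨(isNormal_segPt ψ' (by simp)).1, fun q hq => (hn.2 q hq).trans ?_⟩
    have h0 := hn.2 _ (isNormal_segPt ψ' (m := 0) (by simp)).1
    have h1 := hn.2 _ (isNormal_segPt ψ' (m := 1) (by simp)).1
    rw [hp] at h0 h1 ⊢
    rw [segPt, segPt, inner_joinPt, inner_joinPt] at *
    nlinarith [hm'.1, hm'.2]
  obtain ⟨m₂, hm₂, e2, -⟩ := hA.exists_facePt (segNormal_ne_zero ψ)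
  rw [facePt_segNormal] at e2
  have h2 := congrArg (fun u : E3 => u 2) e2
  simp only [segPt, joinPt, PiLp.toLp_apply, Matrix.cons_val] at h2
  have hd := ellDelta_pos ψ
  have hz : 0 < segZ ψ := by
    have := (sin_cos_pos hψ).2
    rw [segZ]; positivity
  obtain rfl : m₂ = 0 := by
    rw [zero_mul, eq_comm, mul_eq_zero] at h2
    exact h2.resolve_right hz.ne'
  have h1 := congrArg (fun u : E3 => u 1) e2
  have h0 := congrArg (fun u : E3 => u 0) e2
  simp only [segPt, joinPt, PiLp.toLp_apply, Matrix.cons_val, segX, segY] at h1 h0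
  have hd2 : ellDelta ψ' = ellDelta ψ := by
    rw [← sq_eq_sq₀ (ellDelta_pos ψ').le hd.le]; linarith
  rw [hd2] at h0
  have hψψ : ψ = ψ' := injOn_sin_Ioo hψ hψ' (by
    have hr : 0 < (√3 : ℝ) := by positivity
    have h3 : √3 * ellDelta ψ * sin ψ = √3 * ellDelta ψ * sin ψ' := by linarith
    exact mul_left_cancel₀ (by positivity) h3)
  subst hψψ
  exact ⟨rfl, segPt_inj_right hψ hp, rfl⟩

/-- The derivative of `segX`. -/
def segXDeriv (ψ : ℝ) : ℝ := √3 * cos ψ * (2 * ellDelta ψ ^ 2 - 1) / ellDelta ψ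
/-- The derivative of `segY`. -/
def segYDeriv (ψ : ℝ) : ℝ := (√3 * sin ψ) * (√3 * cos ψ)
/-- The derivative of `segZ`. -/
def segZDeriv (ψ : ℝ) : ℝ := √3 * sin ψ * (2 * ellDelta ψ ^ 2 - 1) / (4 * ellDelta ψ ^ 4)
/-- The derivative of `segW`. -/
def segWDeriv (ψ : ℝ) : ℝ := (√3 * sin ψ) * (√3 * cos ψ) / (4 * ellDelta ψ ^ 4)

/-- The derivative of `segPt` along the circles. -/
def segPtDeriv (ψ m : ℝ) : E3 :=
  !₂[(1 - m) * segXDeriv ψ, (1 - m) * segYDeriv ψ + m * segWDeriv ψ, m * segZDeriv ψ]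

/-- The direction vector of a generating segment. -/
def segDir (ψ : ℝ) : E3 := !₂[-segX ψ, segW ψ - segY ψ + 1, segZ ψ]

/-- The derivative of `segNormal`. -/
def segNormalDeriv (ψ : ℝ) : E3 :=
  !₂[√3 * cos ψ / 2,
    (√3 * sin ψ) * (√3 * cos ψ) * (1 + 2 * ellDelta ψ ^ 2) / (8 * ellDelta ψ ^ 3),
    -(√3 * sin ψ) / (8 * ellDelta ψ ^ 3)]

lemma hasDerivAt_inv_ellDelta (ψ : ℝ) : HasDerivAt (fun ψ => 1 / (2 * ellDelta ψ))
    (3 / 8 * sin ψ * cos ψ / ellDelta ψ ^ 3) ψ := by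
  have h := ellDelta_ne_zero ψ
  refine ((hasDerivAt_const ψ (1 : ℝ)).div ((hasDerivAt_ellDelta ψ).const_mul 2)
    (by simpa using h)).congr_deriv ?_
  field_simp
  ring

lemma hasDerivAt_segX (ψ : ℝ) : HasDerivAt segX (segXDeriv ψ) ψ := by
  have h := ellDelta_ne_zero ψ
  have hs := sin_sq_eq_ellDelta ψ
  refine (((hasDerivAt_sin ψ).const_mul √3).mul (hasDerivAt_ellDelta ψ)).congr_deriv ?_
  rw [segXDeriv]
  field_simp
  rw [hs]
  ring

lemma hasDerivAt_segY (ψ : ℝ) : HasDerivAt segY (segYDeriv ψ) ψ := by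
  have h := ellDelta_ne_zero ψ
  refine ((((hasDerivAt_ellDelta ψ).pow 2).const_mul 2).const_sub 1).congr_deriv ?_
  rw [segYDeriv, show √3 * sin ψ * (√3 * cos ψ) = √3 ^ 2 * (sin ψ * cos ψ) by ring, sqrt_three_sq]
  simp
  field_simp
  ring

lemma hasDerivAt_segW (ψ : ℝ) : HasDerivAt segW (segWDeriv ψ) ψ := by
  have h := ellDelta_ne_zero ψ
  refine (((hasDerivAt_const ψ (1 : ℝ)).div (((hasDerivAt_ellDelta ψ).pow 2).const_mul 2)
    (by simpa using h)).sub_const 1).congr_deriv ?_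
  rw [segWDeriv, show √3 * sin ψ * (√3 * cos ψ) = √3 ^ 2 * (sin ψ * cos ψ) by ring, sqrt_three_sq]
  simp
  field_simp

lemma hasDerivAt_segZ (ψ : ℝ) : HasDerivAt segZ (segZDeriv ψ) ψ := by
  have h := ellDelta_ne_zero ψ
  have hc := cos_sq_eq_ellDelta ψ
  refine (((hasDerivAt_cos ψ).const_mul √3).div (((hasDerivAt_ellDelta ψ).pow 2).const_mul 2)
    (by simpa using h)).congr_deriv ?_
  rw [segZDeriv]
  simp
  field_simp
  rw [hc]
  ring

lemma hasDerivAt_segNormal (ψ : ℝ) : HasDerivAt segNormal (segNormalDeriv ψ) ψ := by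
  have h := ellDelta_ne_zero ψ
  refine hasDerivAt_E3 ?_ ?_ ?_
  · exact ((hasDerivAt_sin ψ).const_mul (√3 / 2)).congr_deriv (by ring)
  · refine ((hasDerivAt_inv_ellDelta ψ).sub (hasDerivAt_ellDelta ψ)).congr_deriv ?_
    rw [show √3 * sin ψ * (√3 * cos ψ) = √3 ^ 2 * (sin ψ * cos ψ) by ring, sqrt_three_sq]
    field_simp
    ring
  · have hc := cos_sq_eq_ellDelta ψ
    refine (((hasDerivAt_cos ψ).const_mul √3).div ((hasDerivAt_ellDelta ψ).const_mul 2)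
      (by simpa using h)).congr_deriv ?_
    field_simp
    rw [hc]
    ring

lemma hasDerivAt_segPt_left (ψ m : ℝ) :
    HasDerivAt (fun ψ => segPt ψ m) (segPtDeriv ψ m) ψ :=
  hasDerivAt_E3 ((hasDerivAt_segX ψ).const_mul _)
    ((((hasDerivAt_segY ψ).sub_const _).const_mul _).add
      (((hasDerivAt_segW ψ).add_const _).const_mul _))
    ((hasDerivAt_segZ ψ).const_mul _)

lemma hasDerivAt_segPt_right (ψ m : ℝ) : HasDerivAt (fun m => segPt ψ m) (segDir ψ) m := by
  have h := hasDerivAt_id m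
  have h' := h.const_sub 1
  refine hasDerivAt_E3 ((h'.mul_const _).congr_deriv (by ring))
    (((h'.mul_const _).add (h.mul_const _)).congr_deriv (by ring))
    ((h.mul_const _).congr_deriv (by ring))

lemma differentiable_segPt : Differentiable ℝ fun x : ℝ × ℝ => segPt x.1 x.2 := by
  have hX : Differentiable ℝ segX := fun ψ => (hasDerivAt_segX ψ).differentiableAt
  have hY : Differentiable ℝ segY := fun ψ => (hasDerivAt_segY ψ).differentiableAt
  have hZ : Differentiable ℝ segZ := fun ψ => (hasDerivAt_segZ ψ).differentiableAt
  have hW : Differentiable ℝ segW := fun ψ => (hasDerivAt_segW ψ).differentiableAt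
  exact differentiable_E3 (by fun_prop) (by fun_prop) (by fun_prop)

lemma differentiable_segNormal : Differentiable ℝ segNormal := fun ψ =>
  (hasDerivAt_segNormal ψ).differentiableAt

lemma tripleDet_cone (ψ m s : ℝ) :
    tripleDet (s • segPtDeriv ψ m) (s • segDir ψ) (segPt ψ m) =
      s ^ 2 * ((1 - m) * (3 * cos ψ ^ 2 * (1 + 2 * ellDelta ψ ^ 2) / (4 * ellDelta ψ ^ 3))
        + m * (3 * sin ψ ^ 2 * (1 + 2 * ellDelta ψ ^ 2) / (8 * ellDelta ψ ^ 3))) := by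
  have h := ellDelta_ne_zero ψ
  have hs : (√3 * sin ψ) ^ 2 = 4 * (1 - ellDelta ψ ^ 2) := by
    rw [mul_pow, sqrt_three_sq, sin_sq_eq_ellDelta]; ring
  have hc : (√3 * cos ψ) ^ 2 = 4 * ellDelta ψ ^ 2 - 1 := by
    rw [mul_pow, sqrt_three_sq, cos_sq_eq_ellDelta]; ring
  have e1 : 3 * cos ψ ^ 2 = (√3 * cos ψ) ^ 2 := by rw [mul_pow, sqrt_three_sq]
  have e2 : 3 * sin ψ ^ 2 = (√3 * sin ψ) ^ 2 := by rw [mul_pow, sqrt_three_sq]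
  rw [e1, e2]
  simp only [tripleDet, segPtDeriv, segDir, segPt, joinPt, segX, segY, segZ, segW, segXDeriv,
    segYDeriv, segZDeriv, segWDeriv, PiLp.smul_apply, PiLp.toLp_apply, Matrix.cons_val, smul_eq_mul]
  generalize √3 * sin ψ = S at *
  generalize √3 * cos ψ = v at *
  generalize ellDelta ψ = d at *
  field_simp
  grind

lemma tripleDet_offset (ψ m h : ℝ) :
    tripleDet (segPtDeriv ψ m + h • segNormalDeriv ψ) (segDir ψ) (segNormal ψ) =
      (1 - m) * (3 * cos ψ ^ 2 / ellDelta ψ ^ 2) + m * (3 * sin ψ ^ 2 / (2 * ellDelta ψ ^ 2))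
        + h * (3 / (2 * ellDelta ψ)) := by
  have h := ellDelta_ne_zero ψ
  have hs : (√3 * sin ψ) ^ 2 = 4 * (1 - ellDelta ψ ^ 2) := by
    rw [mul_pow, sqrt_three_sq, sin_sq_eq_ellDelta]; ring
  have hc : (√3 * cos ψ) ^ 2 = 4 * ellDelta ψ ^ 2 - 1 := by
    rw [mul_pow, sqrt_three_sq, cos_sq_eq_ellDelta]; ring
  have e1 : 3 * cos ψ ^ 2 = (√3 * cos ψ) ^ 2 := by rw [mul_pow, sqrt_three_sq]
  have e2 : 3 * sin ψ ^ 2 = (√3 * sin ψ) ^ 2 := by rw [mul_pow, sqrt_three_sq]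
  rw [e1, e2]
  simp only [tripleDet, segPtDeriv, segDir, segNormal, segNormalDeriv, segX, segY, segZ, segW,
    segXDeriv, segYDeriv, segZDeriv, segWDeriv, PiLp.smul_apply, PiLp.add_apply, PiLp.toLp_apply,
    Matrix.cons_val, smul_eq_mul, div_mul_eq_mul_div √3 2]
  generalize √3 * sin ψ = S at *
  generalize √3 * cos ψ = v at *
  generalize ellDelta ψ = d at *
  field_simp
  grind

/-- The volume of a parametrised body, as an iterated integral of the Jacobian determinant. -/
lemma volume_image_eq_iterated {F : ℝ → ℝ → ℝ → E3}
    (hF : Differentiable ℝ fun x : ℝ × ℝ × ℝ => F x.1 x.2.1 x.2.2) {u v w : ℝ → ℝ → ℝ → E3}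
    (hu : ∀ a b c, HasDerivAt (fun s => F s b c) (u a b c) a)
    (hv : ∀ a b c, HasDerivAt (fun s => F a s c) (v a b c) b)
    (hw : ∀ a b c, HasDerivAt (fun s => F a b s) (w a b c) c)
    {J : ℝ → ℝ → ℝ → ℝ} (hdet : ∀ a b c, tripleDet (u a b c) (v a b c) (w a b c) = J a b c)
    (hJ : Continuous fun x : ℝ × ℝ × ℝ => J x.1 x.2.1 x.2.2)
    {α : ℝ} (hα : 0 ≤ α) {g : ℝ → ℝ} (hg : Continuous g) (hg0 : ∀ a ∈ Set.Ioo 0 α, 0 ≤ g a)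
    {D : Set (ℝ × ℝ × ℝ)} (hD : MeasurableSet D) {S : ℝ → Set ℝ}
    (hS : ∀ a, S a =ᵐ[volume] Set.Ioc 0 (g a)) (hSg : ∀ a, S a ⊆ Set.Ioc 0 (g a))
    (hDS : ∀ a b c, (a, b, c) ∈ D ↔ a ∈ Set.Ioo 0 α ∧ b ∈ S a ∧ c ∈ Set.Ioc (0 : ℝ) 1)
    (hinj : Set.InjOn (fun x : ℝ × ℝ × ℝ => F x.1 x.2.1 x.2.2) D)
    (hpos : ∀ a ∈ Set.Ioo 0 α, ∀ b ∈ Set.Ioc 0 (g a), ∀ c ∈ Set.Ioc (0 : ℝ) 1, 0 ≤ J a b c) :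
    volume ((fun x : ℝ × ℝ × ℝ => F x.1 x.2.1 x.2.2) '' D) =
      ENNReal.ofReal (∫ a in (0 : ℝ)..α, ∫ b in (0 : ℝ)..g a, ∫ c in (0 : ℝ)..1, J a b c) := by
  rw [volume_image_eq_lintegral hD hF hinj hu hv hw,
    ← lintegral_eq_iterated hJ hα hg hg0 hD hS hDS hpos]
  refine setLIntegral_congr_fun hD fun x hx => ?_
  obtain ⟨h1, h2, h3⟩ := (hDS x.1 x.2.1 x.2.2).1 hx
  simp only [hdet]
  rw [abs_of_nonneg (hpos _ h1 _ (hSg _ h2) _ h3)]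

/-- The parameter domain of the bodies swept out by generating segments. -/
def segDomain : Set (ℝ × ℝ × ℝ) := Set.Ioo 0 (π / 2) ×ˢ Set.Ioo 0 1 ×ˢ Set.Ioc 0 1

lemma measurableSet_segDomain : MeasurableSet segDomain :=
  measurableSet_Ioo.prod (measurableSet_Ioo.prod measurableSet_Ioc)

/-- The part of the oloid in one quadrant. -/
def conePart : Set E3 := (fun x : ℝ × ℝ × ℝ => x.2.2 • segPt x.1 x.2.1) '' segDomain

/-- The part of the parallel body in one quadrant consisting of the points outside the oloid whose
nearest point in the oloid is in the interior of a generating segment. -/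
def offsetPart : Set E3 :=
  (fun x : ℝ × ℝ × ℝ => segPt x.1 x.2.1 + x.2.2 • segNormal x.1) '' segDomain

lemma injOn_cone :
    Set.InjOn (fun x : ℝ × ℝ × ℝ => x.2.2 • segPt x.1 x.2.1) segDomain := by
  rintro ⟨ψ, m, s⟩ ⟨h1, h2, h3⟩ ⟨ψ', m', s'⟩ ⟨h1', h2', h3'⟩ e
  obtain ⟨rfl, rfl, rfl⟩ := smul_segPt_inj h1 h2 h3.1 h1' h2' h3'.1 e
  rfl

lemma injOn_offset :
    Set.InjOn (fun x : ℝ × ℝ × ℝ => segPt x.1 x.2.1 + x.2.2 • segNormal x.1) segDomain := by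
  rintro ⟨ψ, m, s⟩ ⟨h1, h2, h3⟩ ⟨ψ', m', s'⟩ ⟨h1', h2', h3'⟩ e
  obtain ⟨hp, hs, hn⟩ := (isNormal_segPt ψ (Set.Ioo_subset_Icc_self h2)).eq_of_add_eq
    (isNormal_segPt ψ' (Set.Ioo_subset_Icc_self h2')) (norm_segNormal ψ) (norm_segNormal ψ')
    h3.1 h3'.1 e
  obtain rfl : ψ = ψ' := segNormal_injOn h1 h1' hn
  obtain rfl : m = m' := segPt_inj_right h1 hp
  simp only at hs
  rw [hs]

lemma differentiable_cone :
    Differentiable ℝ fun x : ℝ × ℝ × ℝ => x.2.2 • segPt x.1 x.2.1 :=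
  (differentiable_snd.comp differentiable_snd).fun_smul
    (differentiable_segPt.comp (f := fun x : ℝ × ℝ × ℝ => (x.1, x.2.1)) (by fun_prop))

lemma differentiable_offset :
    Differentiable ℝ fun x : ℝ × ℝ × ℝ => segPt x.1 x.2.1 + x.2.2 • segNormal x.1 :=
  (differentiable_segPt.comp (f := fun x : ℝ × ℝ × ℝ => (x.1, x.2.1)) (by fun_prop)).add
    ((differentiable_snd.comp differentiable_snd).fun_smul
      (differentiable_segNormal.comp differentiable_fst))

lemma measurableSet_offsetPart : MeasurableSet offsetPart :=
  measurableSet_segDomain.image_of_continuousOn_injOn differentiable_offset.continuous.continuousOn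
    injOn_offset

lemma volume_conePart : volume conePart =
    ENNReal.ofReal ((2 * ellipticE (√3 / 2) + ellipticK (√3 / 2)) / 6) := by
  have hd := continuous_ellDelta
  have hd0 := ellDelta_ne_zero
  rw [← integral_cone]
  refine volume_image_eq_iterated (F := fun ψ m s => s • segPt ψ m) differentiable_cone
    (fun ψ m s => (hasDerivAt_segPt_left ψ m).const_smul s)
    (fun ψ m s => (hasDerivAt_segPt_right ψ m).const_smul s)
    (fun ψ m s => ((hasDerivAt_id s).smul_const (segPt ψ m)).congr_deriv (one_smul _ _))
    tripleDet_cone ?_ (by positivity) (g := fun _ => 1) continuous_const (fun _ _ => zero_le_one)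
    measurableSet_segDomain (S := fun _ => Set.Ioo 0 1) (fun _ => Ioo_ae_eq_Ioc)
    (fun _ => Set.Ioo_subset_Ioc_self) (fun _ _ _ => Iff.rfl) injOn_cone
    fun ψ _ m hm s _ => ?_
  · have h3 : ∀ x : ℝ × ℝ × ℝ, 4 * ellDelta x.1 ^ 3 ≠ 0 := fun x =>
      mul_ne_zero (by norm_num) (pow_ne_zero _ (hd0 _))
    have h4 : ∀ x : ℝ × ℝ × ℝ, 8 * ellDelta x.1 ^ 3 ≠ 0 := fun x =>
      mul_ne_zero (by norm_num) (pow_ne_zero _ (hd0 _))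
    fun_prop (disch := assumption)
  · have := ellDelta_pos ψ
    have := sub_nonneg.2 hm.2
    have := hm.1.le
    positivity

lemma volume_offsetPart : volume offsetPart =
    ENNReal.ofReal (π + 3 / 4 * ellipticK (√3 / 2)) := by
  have hd := continuous_ellDelta
  have hd0 := ellDelta_ne_zero
  rw [← integral_offset]
  refine volume_image_eq_iterated (F := fun ψ m h => segPt ψ m + h • segNormal ψ)
    differentiable_offset
    (fun ψ m h => (hasDerivAt_segPt_left ψ m).add ((hasDerivAt_segNormal ψ).const_smul h))
    (fun ψ m h => (hasDerivAt_segPt_right ψ m).add_const _)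
    (fun ψ m h => (((hasDerivAt_id h).smul_const (segNormal ψ)).const_add _).congr_deriv
      (one_smul _ _))
    tripleDet_offset ?_ (by positivity) (g := fun _ => 1) continuous_const (fun _ _ => zero_le_one)
    measurableSet_segDomain (S := fun _ => Set.Ioo 0 1) (fun _ => Ioo_ae_eq_Ioc)
    (fun _ => Set.Ioo_subset_Ioc_self) (fun _ _ _ => Iff.rfl) injOn_offset
    fun ψ _ m hm h hh => ?_
  · have h1 : ∀ x : ℝ × ℝ × ℝ, ellDelta x.1 ^ 2 ≠ 0 := fun x => pow_ne_zero _ (hd0 _)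
    have h2 : ∀ x : ℝ × ℝ × ℝ, 2 * ellDelta x.1 ^ 2 ≠ 0 := fun x =>
      mul_ne_zero (by norm_num) (pow_ne_zero _ (hd0 _))
    have h3 : ∀ x : ℝ × ℝ × ℝ, 2 * ellDelta x.1 ≠ 0 := fun x =>
      mul_ne_zero (by norm_num) (hd0 _)
    fun_prop (disch := assumption)
  · have := ellDelta_pos ψ
    have := sub_nonneg.2 hm.2
    have := hm.1.le
    have := hh.1.le
    positivity

/-- The point of the circle `kA` with angular coordinate `t`. -/
def rimPt (t : ℝ) : E3 := !₂[sin t, -cos t - 1 / 2, 0]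

/-- The unit vector orthogonal to `kA` at `rimPt t` that makes the angle `φ` with the plane. -/
def rimNormal (t φ : ℝ) : E3 := !₂[sin t * cos φ, -cos t * cos φ, sin φ]

lemma norm_rimNormal (t φ : ℝ) : ‖rimNormal t φ‖ = 1 := by
  rw [← sq_eq_sq₀ (norm_nonneg _) zero_le_one, norm_sq_E3]
  simp only [rimNormal, PiLp.toLp_apply, Matrix.cons_val]
  linear_combination cos φ ^ 2 * sin_sq_add_cos_sq t + sin_sq_add_cos_sq φ

lemma radA_rimNormal (t : ℝ) {φ : ℝ} (h : 0 ≤ cos φ) : radA (rimNormal t φ) = cos φ := by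
  rw [radA, sqrt_eq_iff_mul_self_eq (by positivity) h]
  simp only [rimNormal, PiLp.toLp_apply, Matrix.cons_val]
  linear_combination cos φ ^ 2 * sin_sq_add_cos_sq t

lemma facePt_rimNormal (t : ℝ) {φ : ℝ} (h : 0 < cos φ) : facePt (rimNormal t φ) 0 = rimPt t := by
  rw [facePt, radA_rimNormal t h.le]
  have := h.ne'
  apply E3.ext
  · simp [joinPt, rimNormal, rimPt]
    field_simp
  · simp [joinPt, rimNormal, rimPt]
    field_simp
  · simp [joinPt, rimPt]

lemma cos_tilt_pos {t φ : ℝ} (hφ : φ ∈ Set.Ioc 0 (tilt t)) : 0 < cos φ :=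
  cos_pos_of_mem_Ioo ⟨by linarith [hφ.1, pi_pos], by linarith [hφ.2, tilt_lt t]⟩

lemma isNormal_rimPt {t φ : ℝ} (ht : t ∈ Set.Ioo 0 (2 * π / 3)) (hφ : φ ∈ Set.Ioc 0 (tilt t)) :
    IsNormal (rimNormal t φ) (rimPt t) := by
  have hc := cos_tilt_pos hφ
  have hp := one_add_two_cos_pos ht.1.le ht.2
  rw [← facePt_rimNormal t hc]
  refine isNormal_facePt (by simp) ?_
  rw [sub_zero, one_mul, zero_mul, add_zero]
  refine max_le le_rfl ?_
  have htan : tan φ ≤ √(1 + 2 * cos t) := by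
    rw [← arctan_le_arctan_iff, arctan_tan (by linarith [hφ.1, pi_pos])
      (by linarith [hφ.2, tilt_lt t])]
    exact hφ.2
  have hs : 0 ≤ sin φ := sin_nonneg_of_nonneg_of_le_pi hφ.1.le
    (by linarith [hφ.2, tilt_lt t, pi_pos])
  rw [tan_eq_sin_div_cos, div_le_iff₀ hc] at htan
  have h2 : sin φ ^ 2 ≤ (1 + 2 * cos t) * cos φ ^ 2 := by
    have := pow_le_pow_left₀ hs htan 2
    rwa [mul_pow, sq_sqrt hp.le] at this
  have hB : radB (rimNormal t φ) ≤ cos φ + cos t * cos φ := by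
    rw [radB, sqrt_le_iff]
    simp only [rimNormal, PiLp.toLp_apply, Matrix.cons_val]
    constructor <;> nlinarith
  rw [suppA, suppB, radA_rimNormal t hc.le]
  simp only [rimNormal, PiLp.toLp_apply, Matrix.cons_val] at hB ⊢
  linarith

/-- The parameter domain of `rimPart`. -/
def rimDomain : Set (ℝ × ℝ × ℝ) :=
  {x | x.1 ∈ Set.Ioo 0 (2 * π / 3) ∧ x.2.1 ∈ Set.Ioc 0 (tilt x.1) ∧ x.2.2 ∈ Set.Ioc 0 1}

lemma measurableSet_rimDomain : MeasurableSet rimDomain := by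
  have h1 : MeasurableSet {x : ℝ × ℝ × ℝ | x.1 ∈ Set.Ioo 0 (2 * π / 3)} :=
    measurable_fst measurableSet_Ioo
  have h2 : MeasurableSet {x : ℝ × ℝ × ℝ | 0 < x.2.1} :=
    measurableSet_lt measurable_const (by fun_prop)
  have h3 : MeasurableSet {x : ℝ × ℝ × ℝ | x.2.1 ≤ tilt x.1} :=
    measurableSet_le (by fun_prop) (continuous_tilt.measurable.comp measurable_fst)
  have h4 : MeasurableSet {x : ℝ × ℝ × ℝ | x.2.2 ∈ Set.Ioc (0 : ℝ) 1} :=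
    (measurable_snd.comp measurable_snd) measurableSet_Ioc
  exact h1.inter ((h2.inter h3).inter h4)

/-- The part of the parallel body in one quadrant consisting of the points outside the oloid whose
nearest point in the oloid is in `kA`. -/
def rimPart : Set E3 :=
  (fun x : ℝ × ℝ × ℝ => rimPt x.1 + x.2.2 • rimNormal x.1 x.2.1) '' rimDomain

lemma injOn_rim :
    Set.InjOn (fun x : ℝ × ℝ × ℝ => rimPt x.1 + x.2.2 • rimNormal x.1 x.2.1) rimDomain := by
  rintro ⟨t, φ, ρ⟩ ⟨h1, h2, h3⟩ ⟨t', φ', ρ'⟩ ⟨h1', h2', h3'⟩ e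
  simp only at h1 h2 h3 h1' h2' h3' e
  obtain ⟨hp, rfl, hn⟩ := (isNormal_rimPt h1 h2).eq_of_add_eq (isNormal_rimPt h1' h2')
    (norm_rimNormal _ _) (norm_rimNormal _ _) h3.1 h3'.1 e
  have e1 := congrArg (fun u : E3 => u 1) hp
  have e2 := congrArg (fun u : E3 => u 2) hn
  simp only [rimPt, rimNormal, PiLp.toLp_apply, Matrix.cons_val] at e1 e2
  obtain rfl : t = t' := injOn_cos ⟨h1.1.le, by linarith [h1.2, pi_pos]⟩
    ⟨h1'.1.le, by linarith [h1'.2, pi_pos]⟩ (by linarith)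
  obtain rfl : φ = φ' := injOn_sin ⟨by linarith [h2.1, pi_pos], by linarith [h2.2, tilt_lt t]⟩
    ⟨by linarith [h2'.1, pi_pos], by linarith [h2'.2, tilt_lt t]⟩ e2
  rfl

lemma differentiable_rim :
    Differentiable ℝ fun x : ℝ × ℝ × ℝ => rimPt x.1 + x.2.2 • rimNormal x.1 x.2.1 := by
  have hp : Differentiable ℝ fun x : ℝ × ℝ × ℝ => rimPt x.1 :=
    differentiable_E3 (by fun_prop) (by fun_prop) (by fun_prop)
  have hn : Differentiable ℝ fun x : ℝ × ℝ × ℝ => rimNormal x.1 x.2.1 :=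
    differentiable_E3 (by fun_prop) (by fun_prop) (by fun_prop)
  exact hp.add ((differentiable_snd.comp differentiable_snd).fun_smul hn)

lemma measurableSet_rimPart : MeasurableSet rimPart :=
  measurableSet_rimDomain.image_of_continuousOn_injOn differentiable_rim.continuous.continuousOn
    injOn_rim

lemma volume_rimPart :
    volume rimPart = ENNReal.ofReal (3 * π ^ 2 / 16 - constI / 2 + π / 6) := by
  rw [← integral_edge]
  refine volume_image_eq_iterated (F := fun t φ ρ => rimPt t + ρ • rimNormal t φ)
    (J := fun t φ ρ => ρ * (1 + ρ * cos φ))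
    differentiable_rim
    (u := fun t φ ρ => !₂[cos t, sin t, 0] + ρ • !₂[cos t * cos φ, sin t * cos φ, 0])
    (v := fun t φ ρ => ρ • !₂[-(sin t * sin φ), cos t * sin φ, cos φ])
    (fun t φ ρ => ?_) (fun t φ ρ => ?_)
    (fun t φ ρ => (((hasDerivAt_id ρ).smul_const (rimNormal t φ)).const_add _).congr_deriv
      (one_smul _ _))
    (fun t φ ρ => ?_) (by fun_prop) (by positivity) continuous_tilt (fun t _ => tilt_nonneg t)
    measurableSet_rimDomain (S := fun t => Set.Ioc 0 (tilt t)) (fun _ => Filter.EventuallyEq.rfl)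
    (fun _ => subset_rfl) (fun _ _ _ => Iff.rfl) injOn_rim
    fun t _ φ hφ ρ hρ => ?_
  · refine (hasDerivAt_E3 (hasDerivAt_sin t) ?_ (hasDerivAt_const _ _)).add
      (HasDerivAt.const_smul ρ (hasDerivAt_E3 ((hasDerivAt_sin t).mul_const _) ?_
        (hasDerivAt_const _ _)))
    · exact ((hasDerivAt_cos t).neg.sub_const _).congr_deriv (by ring)
    · exact ((hasDerivAt_cos t).neg.mul_const _).congr_deriv (by ring)
  · refine (HasDerivAt.const_smul ρ (hasDerivAt_E3 ?_ ?_ (hasDerivAt_sin φ))).const_add _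
    · exact ((hasDerivAt_cos φ).const_mul _).congr_deriv (by ring)
    · exact ((hasDerivAt_cos φ).const_mul _).congr_deriv (by ring)
  · simp only [tripleDet, rimNormal, PiLp.smul_apply, PiLp.add_apply, PiLp.toLp_apply,
      Matrix.cons_val, smul_eq_mul]
    have h1 := sin_sq_add_cos_sq t
    have h2 := sin_sq_add_cos_sq φ
    generalize sin t = a at *
    generalize cos t = b at *
    generalize sin φ = c at *
    generalize cos φ = d at *
    grind
  · have := cos_tilt_pos hφ
    have := hρ.1.le
    positivity

/-- The points at distance at most one from the oloid. -/
def parBody : Set E3 := {x | (oloid ∩ Metric.closedBall x 1).Nonempty}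

/-- The quadrant where the first and the last coordinate are positive. -/
def quadrant : Set E3 := {x | 0 < x 0 ∧ 0 < x 2}

/-- The point `p` of the oloid is the foot of a unit outer normal vector `u` such that `x` is at
distance at most one from `p` in the direction `u`. -/
def IsFoot (x p : E3) : Prop :=
  ∃ u : E3, ∃ h : ℝ, ‖u‖ = 1 ∧ h ∈ Set.Ioc 0 1 ∧ IsNormal u p ∧ x = p + h • u

lemma IsFoot.unique {x p p' : E3} (h : IsFoot x p) (h' : IsFoot x p') : p = p' := by
  obtain ⟨u, s, hu, hs, hn, rfl⟩ := h
  obtain ⟨u', s', hu', hs', hn', e⟩ := h'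
  exact (hn.eq_of_add_eq hn' hu hu' hs.1 hs'.1 e).1

lemma IsFoot.notMem {x p : E3} (h : IsFoot x p) : x ∉ oloid := by
  obtain ⟨u, s, hu, hs, hn, rfl⟩ := h
  exact hn.add_notMem hu hs.1

lemma IsFoot.mem_parBody {x p : E3} (h : IsFoot x p) : x ∈ parBody := by
  obtain ⟨u, s, hu, hs, hn, rfl⟩ := h
  refine ⟨p, hn.1, ?_⟩
  rw [Metric.mem_closedBall, dist_self_add_right, norm_smul, hu, mul_one, norm_of_nonneg hs.1.le]
  exact hs.2

lemma oloid_subset_parBody : oloid ⊆ parBody := fun x hx =>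
  ⟨x, hx, Metric.mem_closedBall_self zero_le_one⟩

/-- Reflection in the plane containing `kB`. -/
def reflX : E3 ≃ₗᵢ[ℝ] E3 where
  toLinearEquiv := LinearEquiv.ofInvolutive
    { toFun := fun x => !₂[-x 0, x 1, x 2]
      map_add' := fun x y => E3.ext (neg_add _ _) rfl rfl
      map_smul' := fun c x => E3.ext (mul_neg _ _).symm rfl rfl }
    fun x => E3.ext (neg_neg _) rfl rfl
  norm_map' x := by
    rw [← sq_eq_sq₀ (norm_nonneg _) (norm_nonneg _), norm_sq_E3, norm_sq_E3]
    exact congrArg (· + x 1 ^ 2 + x 2 ^ 2) (neg_sq (x 0))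

/-- Reflection in the plane containing `kA`. -/
def reflZ : E3 ≃ₗᵢ[ℝ] E3 where
  toLinearEquiv := LinearEquiv.ofInvolutive
    { toFun := fun x => !₂[x 0, x 1, -x 2]
      map_add' := fun x y => E3.ext rfl rfl (neg_add _ _)
      map_smul' := fun c x => E3.ext rfl rfl (mul_neg _ _).symm }
    fun x => E3.ext rfl rfl (neg_neg _)
  norm_map' x := by
    rw [← sq_eq_sq₀ (norm_nonneg _) (norm_nonneg _), norm_sq_E3, norm_sq_E3]
    exact congrArg (x 0 ^ 2 + x 1 ^ 2 + ·) (neg_sq (x 2))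

/-- The half-turn exchanging `kA` and `kB`. -/
def swapAB : E3 ≃ₗᵢ[ℝ] E3 where
  toLinearEquiv := LinearEquiv.ofInvolutive
    { toFun := fun x => !₂[x 2, -x 1, x 0]
      map_add' := fun x y => E3.ext rfl (neg_add _ _) rfl
      map_smul' := fun c x => E3.ext rfl (mul_neg _ _).symm rfl }
    fun x => E3.ext rfl (neg_neg _) rfl
  norm_map' x := by
    rw [← sq_eq_sq₀ (norm_nonneg _) (norm_nonneg _), norm_sq_E3, norm_sq_E3]
    change x 2 ^ 2 + (-x 1) ^ 2 + x 0 ^ 2 = _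
    ring

lemma swapAB_apply (x : E3) : swapAB x = !₂[x 2, -x 1, x 0] := rfl

lemma reflX_reflX (x : E3) : reflX (reflX x) = x := E3.ext (neg_neg _) rfl rfl

lemma reflZ_reflZ (x : E3) : reflZ (reflZ x) = x := E3.ext rfl rfl (neg_neg _)

lemma swapAB_swapAB (x : E3) : swapAB (swapAB x) = x := E3.ext rfl (neg_neg _) rfl

lemma reflX_mem {p : E3} (hp : p ∈ oloid) : reflX p ∈ oloid := by
  obtain ⟨m, X, Y, Z, W, hm, h1, h2, rfl⟩ := mem_oloid_iff.1 hp
  exact mem_oloid_iff.2 ⟨m, -X, Y, Z, W, hm, by rwa [neg_sq], h2,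
    E3.ext (mul_neg _ _).symm rfl rfl⟩

lemma reflZ_mem {p : E3} (hp : p ∈ oloid) : reflZ p ∈ oloid := by
  obtain ⟨m, X, Y, Z, W, hm, h1, h2, rfl⟩ := mem_oloid_iff.1 hp
  exact mem_oloid_iff.2 ⟨m, X, Y, -Z, W, hm, h1, by rwa [neg_sq],
    E3.ext rfl rfl (mul_neg _ _).symm⟩

lemma swapAB_mem {p : E3} (hp : p ∈ oloid) : swapAB p ∈ oloid := by
  obtain ⟨m, X, Y, Z, W, hm, h1, h2, rfl⟩ := mem_oloid_iff.1 hp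
  refine mem_oloid_iff.2 ⟨1 - m, Z, -W, X, -Y, ⟨sub_nonneg.2 hm.2, sub_le_self _ hm.1⟩,
    by rwa [neg_sq], by rwa [neg_sq], ?_⟩
  rw [swapAB_apply]
  apply E3.ext
  · simp [joinPt]
  · simp [joinPt]
    ring
  · simp [joinPt]

lemma map_mem_parBody {e : E3 ≃ₗᵢ[ℝ] E3} (he : ∀ p ∈ oloid, e p ∈ oloid) {x : E3}
    (hx : x ∈ parBody) : e x ∈ parBody := by
  obtain ⟨q, hq, hqx⟩ := hx
  refine ⟨e q, he q hq, ?_⟩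
  rwa [Metric.mem_closedBall, e.dist_map]

lemma preimage_parBody {e : E3 ≃ₗᵢ[ℝ] E3} (he : ∀ p ∈ oloid, e p ∈ oloid)
    (hee : ∀ x, e (e x) = x) : e ⁻¹' parBody = parBody := by
  ext x
  exact ⟨fun h => hee x ▸ map_mem_parBody he h, fun h => map_mem_parBody he h⟩

lemma IsFoot.map_swapAB {x p : E3} (h : IsFoot x p) : IsFoot (swapAB x) (swapAB p) := by
  obtain ⟨u, s, hu, hs, hn, rfl⟩ := h
  refine ⟨swapAB u, s, by rw [swapAB.norm_map, hu], hs, ⟨swapAB_mem hn.1, fun q hq => ?_⟩,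
    by rw [map_add, map_smul]⟩
  rw [swapAB.inner_map_map, ← swapAB_swapAB q, swapAB.inner_map_map]
  exact hn.2 _ (swapAB_mem hq)

lemma swapAB_facePt_one (u : E3) : swapAB (facePt u 1) = facePt (swapAB u) 0 := by
  rw [swapAB_apply]
  apply E3.ext <;> simp [facePt, joinPt, radA, radB, swapAB_apply]
  ring

lemma suppA_swapAB (u : E3) : suppA (swapAB u) = suppB u := by
  simp [suppA, suppB, radA, radB, swapAB_apply, sub_eq_add_neg, neg_div]

lemma suppB_swapAB (u : E3) : suppB (swapAB u) = suppA u := by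
  rw [← suppA_swapAB, swapAB_swapAB]

lemma facePt_zero_add_mem_rimPart {u : E3} (hu : ‖u‖ = 1) (h0 : 0 < u 0) (h2 : 0 < u 2)
    (hs : suppB u ≤ suppA u) {h : ℝ} (hh : h ∈ Set.Ioc 0 1) : facePt u 0 + h • u ∈ rimPart := by
  have hn : u 0 ^ 2 + u 1 ^ 2 + u 2 ^ 2 = 1 := by rw [← norm_sq_E3, hu, one_pow]
  have hR : 0 < radA u := sqrt_pos.2 (by positivity)
  have hR2 : radA u ^ 2 = u 0 ^ 2 + u 1 ^ 2 := sq_sqrt (by positivity)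
  have hB2 : radB u ^ 2 = u 2 ^ 2 + u 1 ^ 2 := sq_sqrt (by positivity)
  have hB : 0 ≤ radB u := sqrt_nonneg _
  have hkey : u 2 ^ 2 ≤ radA u * (radA u - 2 * u 1) := by
    have h1 : radB u ≤ radA u - u 1 := by rw [suppA, suppB] at hs; linarith
    nlinarith
  have hcos : cos (arccos (-(u 1 / radA u))) = -(u 1 / radA u) := by
    have : |u 1| ≤ radA u := abs_le_of_sq_le_sq (by nlinarith) hR.le
    rw [abs_le] at this
    refine cos_arccos ?_ ?_
    · rw [neg_le_neg_iff, div_le_one hR]; exact this.2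
    · rw [neg_le, le_div_iff₀ hR]; linarith [this.1]
  have hsin : sin (arccos (-(u 1 / radA u))) = u 0 / radA u := by
    rw [sin_arccos, sqrt_eq_iff_mul_self_eq_of_pos (by positivity)]
    field_simp
    linarith
  have hsin' : sin (arcsin (u 2)) = u 2 := sin_arcsin (by linarith) (by nlinarith)
  have hcos' : cos (arcsin (u 2)) = radA u := by
    rw [cos_arcsin, radA]
    congr 1
    linarith
  have hun : rimNormal (arccos (-(u 1 / radA u))) (arcsin (u 2)) = u := by
    apply E3.ext <;>
      simp only [rimNormal, PiLp.toLp_apply, Matrix.cons_val, hcos, hsin, hcos', hsin'] <;>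
      field_simp
  have hpt : rimPt (arccos (-(u 1 / radA u))) = facePt u 0 := by
    rw [← facePt_rimNormal _ (by rw [hcos']; exact hR), hun]
  have ht : -(1 / 2) < -(u 1 / radA u) := by
    rw [neg_lt_neg_iff, div_lt_iff₀ hR]
    have : 0 < radA u - 2 * u 1 := pos_of_mul_pos_right (by nlinarith) hR.le
    linarith
  refine ⟨(arccos (-(u 1 / radA u)), arcsin (u 2), h), ⟨⟨?_, ?_⟩, ⟨?_, ?_⟩, hh⟩, ?_⟩
  · rw [arccos_pos, neg_lt, lt_div_iff₀ hR]
    nlinarith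
  · by_contra! hle
    have := cos_le_cos_of_nonneg_of_le_pi (by positivity) (arccos_le_pi _) hle
    rw [hcos, show 2 * π / 3 = π - π / 3 by ring, cos_pi_sub, cos_pi_div_three] at this
    linarith
  · exact arcsin_pos.2 h2
  · simp only
    rw [tilt, hcos, ← arctan_tan (x := arcsin (u 2))]
    · refine arctan_mono ?_
      rw [tan_eq_sin_div_cos, hsin', hcos']
      refine le_sqrt_of_sq_le ?_
      rw [div_pow, div_le_iff₀ (by positivity)]
      field_simp
      linarith
    · linarith [arcsin_pos.2 h2, pi_pos]
    · rw [arcsin_lt_pi_div_two]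
      nlinarith
  · simp only [hun, hpt]

lemma isFoot_of_mem_offsetPart {x : E3} (hx : x ∈ offsetPart) :
    x ∈ quadrant ∧ ∃ p, IsFoot x p ∧ 0 < p 0 ∧ 0 < p 2 := by
  obtain ⟨⟨ψ, m, h⟩, ⟨h1, h2, h3⟩, rfl⟩ := hx
  obtain ⟨hp0, hp2⟩ := segPt_pos h1 h2
  obtain ⟨hn0, hn2⟩ := segNormal_pos h1
  have hh : 0 < h := h3.1
  refine ⟨⟨?_, ?_⟩, segPt ψ m, ⟨segNormal ψ, h, norm_segNormal ψ, h3,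
    isNormal_segPt ψ (Set.Ioo_subset_Icc_self h2), rfl⟩, hp0, hp2⟩
  · exact add_pos hp0 (mul_pos hh hn0)
  · exact add_pos hp2 (mul_pos hh hn2)

lemma isFoot_of_mem_rimPart {x : E3} (hx : x ∈ rimPart) :
    x ∈ quadrant ∧ ∃ p, IsFoot x p ∧ 0 < p 0 ∧ p 2 = 0 := by
  obtain ⟨⟨t, φ, h⟩, ⟨h1, h2, h3⟩, rfl⟩ := hx
  simp only at h1 h2 h3
  have hc := cos_tilt_pos h2
  have hs : 0 < sin t := sin_pos_of_pos_of_lt_pi h1.1 (by linarith [h1.2, pi_pos])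
  have hs' : 0 < sin φ := sin_pos_of_pos_of_lt_pi h2.1 (by linarith [h2.2, tilt_lt t, pi_pos])
  have hh : 0 < h := h3.1
  refine ⟨⟨?_, ?_⟩, rimPt t, ⟨rimNormal t φ, h, norm_rimNormal t φ, h3,
    isNormal_rimPt h1 h2, rfl⟩, hs, rfl⟩
  · exact add_pos hs (mul_pos hh (mul_pos hs hc))
  · exact add_pos_of_nonneg_of_pos le_rfl (mul_pos hh hs')

lemma isFoot_of_mem_preimage_rimPart {x : E3} (hx : x ∈ swapAB ⁻¹' rimPart) :
    x ∈ quadrant ∧ ∃ p, IsFoot x p ∧ p 0 = 0 := by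
  obtain ⟨hq, p, hp, h0, h2⟩ := isFoot_of_mem_rimPart hx
  exact ⟨⟨hq.2, hq.1⟩, swapAB p, swapAB_swapAB x ▸ hp.map_swapAB, h2⟩

lemma facePt_apply_zero_nonpos {u : E3} {m : ℝ} (hm : m ∈ Set.Icc (0 : ℝ) 1) (hu : u 0 ≤ 0) :
    facePt u m 0 ≤ 0 :=
  mul_nonpos_of_nonneg_of_nonpos (sub_nonneg.2 hm.2) (div_nonpos_of_nonpos_of_nonneg hu
    (sqrt_nonneg _))

lemma facePt_apply_two_nonpos {u : E3} {m : ℝ} (hm : m ∈ Set.Icc (0 : ℝ) 1) (hu : u 2 ≤ 0) :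
    facePt u m 2 ≤ 0 :=
  mul_nonpos_of_nonneg_of_nonpos hm.1 (div_nonpos_of_nonpos_of_nonneg hu (sqrt_nonneg _))

lemma conePart_eq : conePart = oloid ∩ quadrant := by
  ext x
  constructor
  · rintro ⟨⟨ψ, m, s⟩, ⟨h1, h2, h3⟩, rfl⟩
    obtain ⟨hp0, hp2⟩ := segPt_pos h1 h2
    have hs : 0 < s := h3.1
    refine ⟨?_, mul_pos hs hp0, mul_pos hs hp2⟩
    exact convex_oloid.smul_mem_of_zero_mem (ball_subset_oloid (Metric.mem_ball_self (by norm_num)))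
      (isNormal_segPt ψ (Set.Ioo_subset_Icc_self h2)).1 ⟨hs.le, h3.2⟩
  · rintro ⟨hx, h0, h2⟩
    obtain ⟨p, u, s, hu, hs, hn, rfl⟩ := exists_isNormal_smul hx fun h => by simp [h] at h0
    have hp0 : 0 < p 0 := pos_of_mul_pos_right h0 hs.1.le
    have hp2 : 0 < p 2 := pos_of_mul_pos_right h2 hs.1.le
    obtain ⟨m, hm, rfl, hA, hB⟩ := hn.exists_facePt (norm_ne_zero_iff.1 (hu ▸ one_ne_zero))
    have hu0 : 0 < u 0 := by
      by_contra! h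
      exact hp0.not_ge (facePt_apply_zero_nonpos hm h)
    have hu2 : 0 < u 2 := by
      by_contra! h
      exact hp2.not_ge (facePt_apply_two_nonpos hm h)
    have hm0 : m ≠ 0 := by
      rintro rfl
      simp [facePt, joinPt] at hp2
    have hm1 : m ≠ 1 := by
      rintro rfl
      simp [facePt, joinPt] at hp0
    obtain ⟨ψ, hψ, rfl⟩ := exists_segNormal_eq hu hu0 hu2
      (le_antisymm (not_lt.1 fun h => hm0 (hB h)) (not_lt.1 fun h => hm1 (hA h)))
    rw [facePt_segNormal]
    exact ⟨(ψ, m, s), ⟨hψ, ⟨hm.1.lt_of_ne' hm0, hm.2.lt_of_ne hm1⟩, hs⟩, rfl⟩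

lemma parBody_inter_quadrant : parBody ∩ quadrant =
    conePart ∪ (offsetPart ∪ (rimPart ∪ swapAB ⁻¹' rimPart)) := by
  ext x
  constructor
  · rintro ⟨⟨q, hq, hqx⟩, h0, h2⟩
    by_cases hx : x ∈ oloid
    · exact Or.inl (conePart_eq ▸ ⟨hx, h0, h2⟩)
    right
    obtain ⟨p, u, h, hu, hh, hd, hn, rfl⟩ := exists_isNormal_of_notMem hx
    have hh' : h ∈ Set.Ioc 0 1 := ⟨hh, (hd q hq).trans hqx⟩
    obtain ⟨m, hm, rfl, hA, hB⟩ := hn.exists_facePt (norm_ne_zero_iff.1 (hu ▸ one_ne_zero))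
    have hu0 : 0 < u 0 := by
      by_contra! h'
      exact h0.not_ge (add_nonpos (facePt_apply_zero_nonpos hm h')
        (mul_nonpos_of_nonneg_of_nonpos hh.le h'))
    have hu2 : 0 < u 2 := by
      by_contra! h'
      exact h2.not_ge (add_nonpos (facePt_apply_two_nonpos hm h')
        (mul_nonpos_of_nonneg_of_nonpos hh.le h'))
    rcases eq_or_ne m 0 with rfl | hm0
    · exact Or.inr (Or.inl (facePt_zero_add_mem_rimPart hu hu0 hu2
        (not_lt.1 fun h => zero_ne_one (hA h)) hh'))
    rcases eq_or_ne m 1 with rfl | hm1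
    · refine Or.inr (Or.inr ?_)
      rw [Set.mem_preimage, map_add, map_smul, swapAB_facePt_one]
      refine facePt_zero_add_mem_rimPart (by rw [swapAB.norm_map, hu]) hu2 hu0 ?_ hh'
      rw [suppA_swapAB, suppB_swapAB]
      exact not_lt.1 fun h => one_ne_zero (hB h)
    obtain ⟨ψ, hψ, rfl⟩ := exists_segNormal_eq hu hu0 hu2
      (le_antisymm (not_lt.1 fun h => hm0 (hB h)) (not_lt.1 fun h => hm1 (hA h)))
    rw [facePt_segNormal]
    exact Or.inl ⟨(ψ, m, h), ⟨hψ, ⟨hm.1.lt_of_ne' hm0, hm.2.lt_of_ne hm1⟩, hh'⟩, rfl⟩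
  · rintro (hx | hx | hx | hx)
    · rw [conePart_eq] at hx
      exact ⟨oloid_subset_parBody hx.1, hx.2⟩
    · obtain ⟨hq, p, hp, -⟩ := isFoot_of_mem_offsetPart hx
      exact ⟨hp.mem_parBody, hq⟩
    · obtain ⟨hq, p, hp, -⟩ := isFoot_of_mem_rimPart hx
      exact ⟨hp.mem_parBody, hq⟩
    · obtain ⟨hq, p, hp, -⟩ := isFoot_of_mem_preimage_rimPart hx
      exact ⟨hp.mem_parBody, hq⟩

lemma disjoint_conePart :
    Disjoint conePart (offsetPart ∪ (rimPart ∪ swapAB ⁻¹' rimPart)) := by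
  rw [conePart_eq, Set.disjoint_left]
  rintro x ⟨hx, -⟩ (h | h | h)
  · obtain ⟨-, p, hp, -⟩ := isFoot_of_mem_offsetPart h
    exact hp.notMem hx
  · obtain ⟨-, p, hp, -⟩ := isFoot_of_mem_rimPart h
    exact hp.notMem hx
  · obtain ⟨-, p, hp, -⟩ := isFoot_of_mem_preimage_rimPart h
    exact hp.notMem hx

lemma disjoint_offsetPart : Disjoint offsetPart (rimPart ∪ swapAB ⁻¹' rimPart) := by
  rw [Set.disjoint_left]
  rintro x hx h
  obtain ⟨-, p, hp, hp0, hp2⟩ := isFoot_of_mem_offsetPart hx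
  rcases h with h | h
  · obtain ⟨-, p', hp', -, h2⟩ := isFoot_of_mem_rimPart h
    exact hp2.ne' (hp.unique hp' ▸ h2)
  · obtain ⟨-, p', hp', h0⟩ := isFoot_of_mem_preimage_rimPart h
    exact hp0.ne' (hp.unique hp' ▸ h0)

lemma disjoint_rimPart : Disjoint rimPart (swapAB ⁻¹' rimPart) := by
  rw [Set.disjoint_left]
  rintro x hx h
  obtain ⟨-, p, hp, hp0, -⟩ := isFoot_of_mem_rimPart hx
  obtain ⟨-, p', hp', h0⟩ := isFoot_of_mem_preimage_rimPart h
  exact hp0.ne' (hp.unique hp' ▸ h0)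

lemma ellipticK_nonneg (k : ℝ) : 0 ≤ ellipticK k :=
  intervalIntegral.integral_nonneg (by positivity) fun _ _ => by positivity

lemma ellipticE_nonneg (k : ℝ) : 0 ≤ ellipticE k :=
  intervalIntegral.integral_nonneg (by positivity) fun _ _ => sqrt_nonneg _

lemma rim_nonneg : 0 ≤ 3 * π ^ 2 / 16 - constI / 2 + π / 6 := by
  rw [← integral_edge]
  refine intervalIntegral.integral_nonneg (by positivity) fun t _ =>
    intervalIntegral.integral_nonneg (tilt_nonneg t) fun φ hφ =>
      intervalIntegral.integral_nonneg zero_le_one fun ρ hρ => ?_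
  have := cos_nonneg_of_mem_Icc (x := φ) ⟨by linarith [hφ.1, pi_pos], by linarith [hφ.2, tilt_lt t]⟩
  have := hρ.1
  positivity

lemma volume_parBody_inter_quadrant : volume (parBody ∩ quadrant) =
    ENNReal.ofReal ((9 * π ^ 2 + 32 * π + 8 * ellipticE (√3 / 2) + 22 * ellipticK (√3 / 2)
      - 24 * constI) / 24) := by
  have hr := measurableSet_rimPart
  have hs : MeasurableSet (swapAB ⁻¹' rimPart) := swapAB.continuous.measurable hr
  have hK := ellipticK_nonneg (√3 / 2)
  have hE := ellipticE_nonneg (√3 / 2)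
  have hR := rim_nonneg
  rw [parBody_inter_quadrant,
    measure_union disjoint_conePart (measurableSet_offsetPart.union (hr.union hs)),
    measure_union disjoint_offsetPart (hr.union hs), measure_union disjoint_rimPart hs,
    swapAB.measurePreserving.measure_preimage hr.nullMeasurableSet, volume_conePart,
    volume_offsetPart, volume_rimPart, ← ENNReal.ofReal_add hR hR,
    ← ENNReal.ofReal_add (by positivity) (by positivity),
    ← ENNReal.ofReal_add (by positivity) (by positivity)]
  congr 1
  ring

lemma volume_coordinate_plane (i : Fin 3) : volume {x : E3 | x i = 0} = 0 := by
  have h := Measure.addHaar_submodule (volume : Measure E3)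
    (LinearMap.ker (EuclideanSpace.proj i : E3 →L[ℝ] ℝ).toLinearMap) fun h => by
      have : EuclideanSpace.single i (1 : ℝ) ∈
        LinearMap.ker (EuclideanSpace.proj i : E3 →L[ℝ] ℝ).toLinearMap := h ▸ Submodule.mem_top
      simp at this
  exact h

/-- A body which is symmetric in a coordinate plane is cut in half by it. -/
lemma volume_eq_two_mul {e : E3 ≃ₗᵢ[ℝ] E3} {i : Fin 3} (he : ∀ x, e x i = -x i) {S : Set E3}
    (hS : MeasurableSet S) (heS : e ⁻¹' S = S) :
    volume S = 2 * volume (S ∩ {x | 0 < x i}) := by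
  have hm : MeasurableSet {x : E3 | 0 < x i} := measurableSet_lt measurable_const (by fun_prop)
  have h : volume (S \ {x | 0 < x i}) = volume (S ∩ {x | 0 < x i}) := by
    rw [← e.measurePreserving.measure_preimage (hS.inter hm).nullMeasurableSet, Set.preimage_inter,
      heS]
    refine measure_congr ?_
    filter_upwards [measure_eq_zero_iff_ae_notMem.1 (volume_coordinate_plane i)] with x hx
    have : x i ≠ 0 := hx
    refine propext (and_congr_right fun _ => ?_)
    change ¬ 0 < x i ↔ 0 < e x i
    rw [he, not_lt, neg_pos, le_iff_lt_or_eq, or_iff_left this]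
  rw [← measure_inter_add_sdiff S hm, h, two_mul]

lemma isClosed_parBody : IsClosed parBody := by
  have : parBody = Metric.cthickening 1 oloid := by
    rw [isCompact_oloid.cthickening_eq_biUnion_closedBall zero_le_one]
    ext x
    simp [parBody, Set.Nonempty, dist_comm]
  exact this ▸ Metric.isClosed_cthickening

lemma volume_parBody : volume parBody =
    ENNReal.ofReal ((9 * π ^ 2 + 32 * π + 8 * ellipticE (√3 / 2) + 22 * ellipticK (√3 / 2)
      - 24 * constI) / 6) := by
  have hP := isClosed_parBody.measurableSet
  have hm : MeasurableSet {x : E3 | 0 < x 0} := measurableSet_lt measurable_const (by fun_prop)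
  rw [volume_eq_two_mul (e := reflX) (i := 0) (fun _ => rfl) hP
      (preimage_parBody (fun _ => reflX_mem) reflX_reflX),
    volume_eq_two_mul (e := reflZ) (i := 2) (fun _ => rfl) (hP.inter hm)
      (by rw [Set.preimage_inter, preimage_parBody (fun _ => reflZ_mem) reflZ_reflZ]; rfl),
    Set.inter_assoc]
  change 2 * (2 * volume (parBody ∩ quadrant)) = _
  rw [volume_parBody_inter_quadrant, ← ENNReal.ofReal_ofNat 2,
    ← ENNReal.ofReal_mul (by norm_num), ← ENNReal.ofReal_mul (by norm_num)]
  congr 1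
  ring

lemma setOf_hitting_eq {r : ℝ} (hr : 0 < r) :
    {x : E3 | (oloidR r ∩ Metric.closedBall x r).Nonempty} = r • parBody := by
  ext x
  rw [Set.mem_smul_set_iff_inv_smul_mem₀ hr.ne']
  have hb : Metric.closedBall x r = r • Metric.closedBall (r⁻¹ • x) 1 := by
    rw [smul_closedBall _ _ zero_le_one, smul_inv_smul₀ hr.ne', norm_of_nonneg hr.le, mul_one]
  simp only [Set.mem_ofPred_eq, parBody, oloidR]
  rw [hb, ← Set.smul_set_inter₀ hr.ne', Set.smul_set_nonempty]

/-- The Lebesgue measure of the set of positions of a moving ball of radius `r` hitting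
the oloid `Ω_r` equals `(r³/6)·[9π² + 32π + 8E(√3/2) + 22K(√3/2) − 24I]`. -/
theorem measure_hitting_ball (r : ℝ) (hr : 0 < r) :
    volume {x : EuclideanSpace ℝ (Fin 3) | (oloidR r ∩ Metric.closedBall x r).Nonempty} =
      ENNReal.ofReal
        (r ^ 3 / 6 * (9 * π ^ 2 + 32 * π + 8 * ellipticE (Real.sqrt 3 / 2)
          + 22 * ellipticK (Real.sqrt 3 / 2) - 24 * constI)) := by
  rw [setOf_hitting_eq hr, Measure.addHaar_smul, volume_parBody, finrank_euclideanSpace_fin,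
    abs_of_pos (by positivity), ← ENNReal.ofReal_mul (by positivity)]
  congr 1
  ring
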